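/- (Geometric forward-reverse Brascamp-Lieb inequality with gaussian weights.) Let H be a Euclidean space and Q a self-adjoint operator on H whose number of positive eigenvalues, counted with multiplicity, is s⁺(Q). Let U_i: H → E_i and V_j: H → E^j be linear maps with U_i U_i* = id_{E_i} and V_j V_j* = id_{E^j} for all 1≤i≤k, 1≤j≤m. Suppose Q + Σ_{i=1}^k c_i U_i* U_i = Σ_{j=1}^m d_j V_j* V_j, this common operator is positive-definite, and dim(H) ≥ s⁺(Q) + Σ_{i=1}^k dim(E_i). If measurable functions f_i: E_i → [0,∞) and g_j: E^j → [0,∞) satisfy ∏_{i=1}^k f_i(U_i x)^{c_i} ≤ ∏_{j=1}^m g_j(V_j x)^{d_j} for all x ∈ H, then ∏_{i=1}^k (∫_{E_i} f_i dγ_{E_i})^{c_i} ≤ ∏_{j=1}^m (∫_{E^j} g_j dγ_{E^j})^{d_j}. -/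

import Mathlib

open MeasureTheory LinearMap
open scoped RealInnerProductSpace BigOperators NNReal ENNReal

noncomputable section

namespace FRBL

/-- A positive semidefinite (self-adjoint) operator on a real inner product space. -/
def PosSemidef {G : Type*} [NormedAddCommGroup G] [InnerProductSpace ℝ G]
    (A : G →ₗ[ℝ] G) : Prop :=
  A.IsSymmetric ∧ ∀ x : G, 0 ≤ ⟪A x, x⟫

/-- A positive definite (self-adjoint) operator on a real inner product space. -/
def PosDef {G : Type*} [NormedAddCommGroup G] [InnerProductSpace ℝ G]
    (A : G →ₗ[ℝ] G) : Prop :=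
  A.IsSymmetric ∧ ∀ x : G, x ≠ 0 → 0 < ⟪A x, x⟫

variable {k m : ℕ}
  (E : Fin k → Type*) (F : Fin m → Type*)
  [∀ i, NormedAddCommGroup (E i)] [∀ i, InnerProductSpace ℝ (E i)]
  [∀ i, FiniteDimensional ℝ (E i)]
  [∀ i, MeasurableSpace (E i)] [∀ i, BorelSpace (E i)]
  [∀ j, NormedAddCommGroup (F j)] [∀ j, InnerProductSpace ℝ (F j)]
  [∀ j, FiniteDimensional ℝ (F j)]
  [∀ j, MeasurableSpace (F j)] [∀ j, BorelSpace (F j)]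
  (c : Fin k → ℝ) (d : Fin m → ℝ)
  (B : ∀ i j, E i →ₗ[ℝ] F j)

/-- The pointwise domination hypothesis of the forward-reverse Brascamp-Lieb inequality. -/
def Hyp (f : ∀ i, E i → ℝ≥0) (g : ∀ j, F j → ℝ≥0) : Prop :=
  ∀ x : ∀ i, E i,
    (∏ i, f i (x i) ^ c i) ≤ ∏ j, g j (∑ i, c i • B i j (x i)) ^ d j

/-- `D₀` is an admissible constant for the forward-reverse Brascamp-Lieb inequality. -/
def IsBound (D₀ : ℝ) : Prop :=
  ∀ (f : ∀ i, E i → ℝ≥0) (g : ∀ j, F j → ℝ≥0),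
    (∀ i, Measurable (f i)) → (∀ j, Measurable (g j)) →
    Hyp E F c d B f g →
    (∏ i, (∫⁻ x, (f i x : ℝ≥0∞)) ^ c i) ≤
      ENNReal.ofReal (Real.exp D₀) * ∏ j, (∫⁻ y, (g j y : ℝ≥0∞)) ^ d j

/-- The best constant `D(c,d,B)` in the forward-reverse Brascamp-Lieb inequality. -/
def D : EReal :=
  sInf {x : EReal | ∃ D₀ : ℝ, x = (D₀ : EReal) ∧ IsBound E F c d B D₀}

/-- The gaussian constraint `Λ_c B* U_d B Λ_c ≤ V_c`, written via quadratic forms. -/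
def GaussCon (V : ∀ i, E i →ₗ[ℝ] E i) (U : ∀ j, F j →ₗ[ℝ] F j) : Prop :=
  ∀ x : ∀ i, E i,
    (∑ j, d j * ⟪U j (∑ i, c i • B i j (x i)), ∑ i, c i • B i j (x i)⟫) ≤
      ∑ i, c i * ⟪V i (x i), x i⟫

/-- The objective functional in the definition of the gaussian constant. -/
def gaussObj (V : ∀ i, E i →ₗ[ℝ] E i) (U : ∀ j, F j →ₗ[ℝ] F j) : ℝ :=
  (∑ j, d j * Real.log (LinearMap.det (U j)) -
    ∑ i, c i * Real.log (LinearMap.det (V i))) / 2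

/-- The gaussian best constant `D_g(c,d,B)`. -/
def Dg : EReal :=
  sSup {x : EReal | ∃ (V : ∀ i, E i →ₗ[ℝ] E i) (U : ∀ j, F j →ₗ[ℝ] F j),
    (∀ i, PosDef (V i)) ∧ (∀ j, PosDef (U j)) ∧ GaussCon E F c d B V U ∧
    x = (gaussObj E F c d V U : EReal)}

/-- The datum `(c,d,B)` is gaussian-extremizable: the supremum defining `D_g` is
finite and attained. -/
def GaussExt : Prop :=
  ∃ (V : ∀ i, E i →ₗ[ℝ] E i) (U : ∀ j, F j →ₗ[ℝ] F j),
    (∀ i, PosDef (V i)) ∧ (∀ j, PosDef (U j)) ∧ GaussCon E F c d B V U ∧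
    Dg E F c d B = (gaussObj E F c d V U : EReal)

/-- The canonical linear equivalence between `E₀ = ⊕ᵢ Eᵢ` (as `PiLp 2`) and the pi type. -/
def toPi : PiLp 2 E ≃ₗ[ℝ] ∀ i, E i := WithLp.linearEquiv 2 ℝ (∀ i, E i)

/-- Orthogonal projection `π_{E_i} : E₀ → E_i`. -/
def projL (i : Fin k) : PiLp 2 E →ₗ[ℝ] E i := (LinearMap.proj i).comp (toPi E).toLinearMap

/-- The embedding `E_i → E₀`. -/
def singleL (i : Fin k) : E i →ₗ[ℝ] PiLp 2 E :=
  (toPi E).symm.toLinearMap.comp (LinearMap.single ℝ E i)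

/-- The map `B_j : E₀ → E^j`, `x ↦ ∑ᵢ B_{ij} π_{E_i} x`. -/
def Bop (j : Fin m) : PiLp 2 E →ₗ[ℝ] F j := ∑ i, (B i j).comp (projL E i)

/-- `Λ_c = ⊕ᵢ cᵢ id_{E_i}` as an operator on `E₀`. -/
def Lam : PiLp 2 E →ₗ[ℝ] PiLp 2 E := ∑ i, c i • (singleL E i).comp (projL E i)

/-- The set `Π(A_1, …, A_k)` of positive semidefinite "couplings". -/
def Coupling (A : ∀ i, E i →ₗ[ℝ] E i) : Set (PiLp 2 E →ₗ[ℝ] PiLp 2 E) :=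
  {P | PosSemidef P ∧ ∀ (i : Fin k) (v : E i),
    ⟪P (singleL E i v), singleL E i v⟫ = ⟪A i v, v⟫}

/-- The scaling condition `∑ᵢ cᵢ dim Eᵢ = ∑ⱼ dⱼ dim E^j`. -/
def ScalingCond : Prop :=
  ∑ i, c i * (Module.finrank ℝ (E i) : ℝ) = ∑ j, d j * (Module.finrank ℝ (F j) : ℝ)

/-- A subspace `T ⊆ E₀` is of product form, i.e. `T = ⊕ᵢ π_{E_i} T`. -/
def ProductForm (T : Submodule ℝ (PiLp 2 E)) : Prop :=
  ∀ x ∈ T, ∀ i, singleL E i (projL E i x) ∈ T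

/-- The dimension condition over product-form subspaces. -/
def DimCond : Prop :=
  ∀ T : Submodule ℝ (PiLp 2 E), ProductForm E T →
    (∑ i, c i * (Module.finrank ℝ (T.map (projL E i)) : ℝ)) ≤
      ∑ j, d j * (Module.finrank ℝ (T.map (Bop E F B j)) : ℝ)

/-- A critical subspace. -/
def IsCritical (T : Submodule ℝ (PiLp 2 E)) : Prop :=
  T ≠ ⊥ ∧ T ≠ ⊤ ∧ ProductForm E T ∧
    ∑ i, c i * (Module.finrank ℝ (T.map (projL E i)) : ℝ) =
      ∑ j, d j * (Module.finrank ℝ (T.map (Bop E F B j)) : ℝ)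

/-- The datum is simple if it has no critical subspace. -/
def Simple : Prop := ∀ T : Submodule ℝ (PiLp 2 E), ¬ IsCritical E F c d B T

end FRBL

namespace FRBL

/-- `log det` with value `−∞` on operators with non-positive determinant
(in particular on singular positive-semidefinite operators). -/
def elogdet {G : Type*} [AddCommGroup G] [Module ℝ G] (A : G →ₗ[ℝ] G) : EReal :=
  if 0 < LinearMap.det A then ((Real.log (LinearMap.det A) : ℝ) : EReal) else ⊥

variable {k m : ℕ}
  (E : Fin k → Type*) (F : Fin m → Type*)
  [∀ i, NormedAddCommGroup (E i)] [∀ i, InnerProductSpace ℝ (E i)]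
  [∀ i, FiniteDimensional ℝ (E i)]
  [∀ j, NormedAddCommGroup (F j)] [∀ j, InnerProductSpace ℝ (F j)]
  [∀ j, FiniteDimensional ℝ (F j)]
  (c : Fin k → ℝ) (d : Fin m → ℝ)
  (B : ∀ i j, E i →ₗ[ℝ] F j)

/-- The map `Q_j := B_j Λ_c : E₀ → E^j`. -/
def BLam (j : Fin m) : PiLp 2 E →ₗ[ℝ] F j := (Bop E F B j).comp (Lam E c)

/-- The optimality condition of Theorem 2 (structure of gaussian extremizers):
each `B_j Λ_c Π Λ_c B_j*` is invertible and
`∑ⱼ dⱼ Λ_c B_j* (B_j Λ_c Π Λ_c B_j*)⁻¹ B_j Λ_c ≤ V_c` in the quadratic-form sense. -/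
def ExtCond (V : ∀ i, E i →ₗ[ℝ] E i) (P : PiLp 2 E →ₗ[ℝ] PiLp 2 E) : Prop :=
  (∀ j, IsUnit ((BLam E F c B j) ∘ₗ P ∘ₗ LinearMap.adjoint (BLam E F c B j))) ∧
  ∀ x : PiLp 2 E,
    (∑ j, d j * ⟪Ring.inverse ((BLam E F c B j) ∘ₗ P ∘ₗ LinearMap.adjoint (BLam E F c B j))
        (BLam E F c B j x), BLam E F c B j x⟫) ≤
      ∑ i, c i * ⟪V i (projL E i x), projL E i x⟫

/-- A geometric datum. -/
def Geometric : Prop :=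
  ScalingCond E F c d ∧
  ∃ S ∈ Coupling E (fun i => (LinearMap.id : E i →ₗ[ℝ] E i)),
    (∀ j, (BLam E F c B j) ∘ₗ S ∘ₗ LinearMap.adjoint (BLam E F c B j) = LinearMap.id) ∧
    ∀ x : PiLp 2 E, (∑ j, d j * ⟪BLam E F c B j x, BLam E F c B j x⟫) ≤ ⟪Lam E c x, x⟫

/-- Equivalence of data: `B'_j = C_j⁻¹ B_j C⁻¹` for invertible `C, C_j`. -/
def EquivData (B' : ∀ i j, E i →ₗ[ℝ] F j) : Prop :=
  ∃ (C : PiLp 2 E ≃ₗ[ℝ] PiLp 2 E) (Cj : ∀ j, F j ≃ₗ[ℝ] F j),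
    ∀ j, Bop E F B' j =
      ((Cj j).symm.toLinearMap ∘ₗ Bop E F B j) ∘ₗ C.symm.toLinearMap

/-- `V_c = ⊕ᵢ cᵢ Vᵢ` as an operator on `E₀`. -/
def blockDiag (V : ∀ i, E i →ₗ[ℝ] E i) : PiLp 2 E →ₗ[ℝ] PiLp 2 E :=
  ∑ i, c i • ((singleL E i) ∘ₗ (V i)) ∘ₗ (projL E i)

/-- `Θ = V_c − ∑ⱼ dⱼ Λ_c B_j* U_j B_j Λ_c`. -/
def Theta (V : ∀ i, E i →ₗ[ℝ] E i) (U : ∀ j, F j →ₗ[ℝ] F j) :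
    PiLp 2 E →ₗ[ℝ] PiLp 2 E :=
  blockDiag E c V -
    ∑ j, d j • (LinearMap.adjoint (BLam E F c B j) ∘ₗ (U j)) ∘ₗ (BLam E F c B j)

end FRBL

namespace FRBL

/-- Borel structure on submodules (inherited from the ambient space). -/
instance subBorel {G : Type*} [AddCommGroup G] [Module ℝ G] [TopologicalSpace G]
    [MeasurableSpace G] [BorelSpace G] (T : Submodule ℝ G) : BorelSpace ↥T :=
  Subtype.borelSpace (T : Set G)

/-- The maximal dimension of a subspace on which the self-adjoint operator `Q` is positive
definite; by Sylvester's law of inertia this is the number of positive eigenvalues of `Q`,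
counted with multiplicity. -/
def posIndex {H : Type*} [NormedAddCommGroup H] [InnerProductSpace ℝ H]
    (Q : H →ₗ[ℝ] H) : ℕ :=
  sSup {r : ℕ | ∃ W : Submodule ℝ H,
    (∀ x ∈ W, x ≠ 0 → 0 < ⟪Q x, x⟫) ∧ Module.finrank ℝ W = r}

/-- The standard gaussian probability measure on a Euclidean space. -/
def stdGaussian (G : Type*) [NormedAddCommGroup G] [InnerProductSpace ℝ G]
    [FiniteDimensional ℝ G] [MeasurableSpace G] [BorelSpace G] :
    Measure G :=
  volume.withDensity fun x =>
    ENNReal.ofReal ((2 * Real.pi) ^ (-(Module.finrank ℝ G : ℝ) / 2) *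
      Real.exp (-‖x‖ ^ 2 / 2))

/-- `K_s = (|s|^{1/s} |s'|^{1/s'})^{1/2}`. -/
def Kconst (s s' : ℝ) : ℝ := Real.sqrt (|s| ^ (1 / s) * |s'| ^ (1 / s'))

variable {k m : ℕ}
  (E : Fin k → Type*) (F : Fin m → Type*)
  [∀ i, NormedAddCommGroup (E i)] [∀ i, InnerProductSpace ℝ (E i)]
  [∀ i, FiniteDimensional ℝ (E i)]
  [∀ j, NormedAddCommGroup (F j)] [∀ j, InnerProductSpace ℝ (F j)]
  [∀ j, FiniteDimensional ℝ (F j)]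
  (c : Fin k → ℝ) (d : Fin m → ℝ)
  (B : ∀ i j, E i →ₗ[ℝ] F j)

/-- The objective functional `∑ⱼ dⱼ log det Uⱼ − ∑ᵢ cᵢ log det Vᵢ`. -/
def objective (V : ∀ i, E i →ₗ[ℝ] E i) (U : ∀ j, F j →ₗ[ℝ] F j) : ℝ :=
  ∑ j, d j * Real.log (LinearMap.det (U j)) - ∑ i, c i * Real.log (LinearMap.det (V i))

/-- Feasibility for the optimization problem defining `D_g`: positive definiteness
together with the constraint `Θ ≥ 0`. -/
def Admissible (V : ∀ i, E i →ₗ[ℝ] E i) (U : ∀ j, F j →ₗ[ℝ] F j) : Prop :=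
  (∀ i, PosDef (V i)) ∧ (∀ j, PosDef (U j)) ∧ PosSemidef (Theta E F c d B V U)

/-- Global maximality in the optimization problem defining `D_g`. -/
def IsGlobalMax (V : ∀ i, E i →ₗ[ℝ] E i) (U : ∀ j, F j →ₗ[ℝ] F j) : Prop :=
  Admissible E F c d B V U ∧
    ∀ V' U', Admissible E F c d B V' U' →
      objective E F c d V' U' ≤ objective E F c d V U

/-- Local maximality in the optimization problem defining `D_g`. -/
def IsLocalMax (V : ∀ i, E i →ₗ[ℝ] E i) (U : ∀ j, F j →ₗ[ℝ] F j) : Prop :=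
  Admissible E F c d B V U ∧
    ∃ ε : ℝ, 0 < ε ∧
      ∀ V' U', Admissible E F c d B V' U' →
        (∀ i, ‖LinearMap.toContinuousLinearMap (V' i - V i)‖ < ε) →
        (∀ j, ‖LinearMap.toContinuousLinearMap (U' j - U j)‖ < ε) →
        objective E F c d V' U' ≤ objective E F c d V U

end FRBL

namespace FRBL

section Gaussian

variable {G : Type*} [NormedAddCommGroup G] [InnerProductSpace ℝ G]
  [FiniteDimensional ℝ G] [MeasurableSpace G] [BorelSpace G]

theorem lintegral_gaussianDensity :
    ∫⁻ x : G, ENNReal.ofReal ((2 * Real.pi) ^ (-(Module.finrank ℝ G : ℝ) / 2) *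
      Real.exp (-‖x‖ ^ 2 / 2)) = 1 := by
  have h := GaussianFourier.integral_rexp_neg_mul_sq_norm (V := G) (b := 1 / 2) (by norm_num)
  have hfun : (fun x : G => Real.exp (-‖x‖ ^ 2 / 2)) = fun v => Real.exp (-(1 / 2) * ‖v‖ ^ 2) := by
    ext x; congr 1; ring
  have hpos : (0 : ℝ) < (Real.pi / (1 / 2)) ^ ((Module.finrank ℝ G : ℝ) / 2) := by positivity
  have hi : Integrable (fun x : G => Real.exp (-‖x‖ ^ 2 / 2)) := by
    rw [hfun]
    by_contra hn
    rw [integral_undef hn] at h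
    exact hpos.ne h
  rw [← ofReal_integral_eq_lintegral_ofReal (hi.const_mul _)
    (Filter.Eventually.of_forall fun x => by positivity), integral_const_mul, hfun, h]
  rw [show Real.pi / (1 / 2) = 2 * Real.pi by ring, ← Real.rpow_add (by positivity)]
  simp [neg_div]

instance isProbabilityMeasure_stdGaussian : IsProbabilityMeasure (stdGaussian G) :=
  ⟨by rw [stdGaussian, withDensity_apply _ MeasurableSet.univ, setLIntegral_univ,
    lintegral_gaussianDensity]⟩

theorem integral_stdGaussian_eq {X : Type*} [NormedAddCommGroup X] [NormedSpace ℝ X] (f : G → X) :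
    ∫ x, f x ∂(stdGaussian G) = ∫ x, ((2 * Real.pi) ^ (-(Module.finrank ℝ G : ℝ) / 2) *
      Real.exp (-‖x‖ ^ 2 / 2)) • f x := by
  rw [stdGaussian, integral_withDensity_eq_integral_toReal_smul (by fun_prop) (by simp)]
  refine integral_congr_ae (Filter.Eventually.of_forall fun x => ?_)
  simp only
  rw [ENNReal.toReal_ofReal (by positivity)]

theorem stdGaussian_eq : stdGaussian G = ProbabilityTheory.stdGaussian G := by
  refine Measure.ext_of_charFun ?_
  ext t
  rw [ProbabilityTheory.charFun_stdGaussian, charFun_apply, integral_stdGaussian_eq]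
  have h := GaussianFourier.integral_cexp_neg_mul_sq_norm_add (V := G) (b := 1 / 2) (by norm_num)
    Complex.I t
  have h2 : ∀ x : G, ((2 * Real.pi) ^ (-(Module.finrank ℝ G : ℝ) / 2) *
      Real.exp (-‖x‖ ^ 2 / 2)) • Complex.exp (⟪x, t⟫ * Complex.I) =
      (((2 * Real.pi) ^ (-(Module.finrank ℝ G : ℝ) / 2) : ℝ) : ℂ) *
      Complex.exp (-(1 / 2) * (‖x‖ : ℂ) ^ 2 + Complex.I * ⟪t, x⟫) := by
    intro x
    rw [Complex.real_smul, Complex.ofReal_mul, mul_assoc, Complex.ofReal_exp, ← Complex.exp_add,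
      real_inner_comm]
    congr 2
    push_cast
    ring
  simp_rw [h2]
  rw [integral_const_mul, h, ← mul_assoc]
  have h3 : (((2 * Real.pi) ^ (-(Module.finrank ℝ G : ℝ) / 2) : ℝ) : ℂ) *
      ((Real.pi : ℂ) / (1 / 2)) ^ ((Module.finrank ℝ G : ℂ) / 2) = 1 := by
    rw [show ((Real.pi : ℂ) / (1 / 2)) = ((2 * Real.pi : ℝ) : ℂ) by push_cast; ring,
      show ((Module.finrank ℝ G : ℂ) / 2) = (((Module.finrank ℝ G : ℝ) / 2 : ℝ) : ℂ) by
        push_cast; ring,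
      ← Complex.ofReal_cpow (by positivity), ← Complex.ofReal_mul, ← Real.rpow_add (by positivity)]
    simp [neg_div]
  rw [h3, one_mul]
  congr 1
  rw [Complex.I_sq]
  ring

instance isGaussian_stdGaussian : ProbabilityTheory.IsGaussian (stdGaussian G) := by
  rw [stdGaussian_eq]; infer_instance

theorem charFun_stdGaussian (t : G) :
    charFun (stdGaussian G) t = Complex.exp (-(‖t‖ : ℂ) ^ 2 / 2) := by
  rw [stdGaussian_eq, ProbabilityTheory.charFun_stdGaussian]

/-- A co-isometry pushes the standard gaussian measure forward to the standard one. -/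
theorem map_stdGaussian_of_comp_adjoint {X : Type*} [NormedAddCommGroup X] [InnerProductSpace ℝ X]
    [FiniteDimensional ℝ X] [MeasurableSpace X] [BorelSpace X] (U : G →ₗ[ℝ] X)
    (hU : U ∘ₗ LinearMap.adjoint U = LinearMap.id) :
    (stdGaussian G).map U = stdGaussian X := by
  have hc : Continuous U := U.continuous_of_finiteDimensional
  have : IsProbabilityMeasure ((stdGaussian G).map U) :=
    Measure.isProbabilityMeasure_map hc.measurable.aemeasurable
  refine Measure.ext_of_charFun ?_
  ext t
  have h1 : charFun ((stdGaussian G).map U) t = charFun (stdGaussian G) (LinearMap.adjoint U t) := by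
    rw [charFun_apply, charFun_apply, integral_map hc.measurable.aemeasurable (by fun_prop)]
    simp_rw [LinearMap.adjoint_inner_right]
  have h2 : ‖LinearMap.adjoint U t‖ ^ 2 = ‖t‖ ^ 2 := by
    rw [← real_inner_self_eq_norm_sq, ← real_inner_self_eq_norm_sq, LinearMap.adjoint_inner_left]
    have := LinearMap.congr_fun hU t
    simp only [LinearMap.comp_apply, LinearMap.id_apply] at this
    rw [this]
  rw [h1, charFun_stdGaussian, charFun_stdGaussian]
  norm_cast
  rw [h2]

theorem integral_comp_of_comp_adjoint {X : Type*} [NormedAddCommGroup X] [InnerProductSpace ℝ X]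
    [FiniteDimensional ℝ X] [MeasurableSpace X] [BorelSpace X] (U : G →ₗ[ℝ] X)
    (hU : U ∘ₗ LinearMap.adjoint U = LinearMap.id) {φ : X → ℝ} (hφ : Measurable φ) :
    ∫ z, φ (U z) ∂(stdGaussian G) = ∫ z, φ z ∂(stdGaussian X) := by
  have hc : Continuous U := U.continuous_of_finiteDimensional
  rw [← map_stdGaussian_of_comp_adjoint U hU, integral_map hc.measurable.aemeasurable
    hφ.aestronglyMeasurable]

/-- The sum of two independent scaled gaussians is a scaled gaussian. -/
theorem map_prod_stdGaussian (s t : ℝ) (hs : 0 ≤ s) (ht : 0 ≤ t) :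
    ((stdGaussian G).prod (stdGaussian G)).map (fun p => √s • p.1 + √t • p.2) =
      (stdGaussian G).map (fun z => √(s + t) • z) := by
  have e : ((stdGaussian G).prod (stdGaussian G)).map (fun p => √s • p.1 + √t • p.2) =
      (((stdGaussian G).map (√s • ·)).prod ((stdGaussian G).map (√t • ·))).map
        (fun p => p.1 + p.2) := by
    rw [Measure.map_prod_map _ _ (by fun_prop) (by fun_prop), Measure.map_map (by fun_prop)
      (by fun_prop)]
    rfl
  have i1 : IsProbabilityMeasure ((stdGaussian G).map (√s • ·)) :=
    Measure.isProbabilityMeasure_map (by fun_prop)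
  have i2 : IsProbabilityMeasure ((stdGaussian G).map (√t • ·)) :=
    Measure.isProbabilityMeasure_map (by fun_prop)
  have i3 : IsProbabilityMeasure ((stdGaussian G).map (√(s + t) • ·)) :=
    Measure.isProbabilityMeasure_map (by fun_prop)
  have i4 : IsProbabilityMeasure ((((stdGaussian G).map (√s • ·)).prod
      ((stdGaussian G).map (√t • ·))).map (fun p => p.1 + p.2)) :=
    Measure.isProbabilityMeasure_map (by fun_prop)
  rw [e]
  refine Measure.ext_of_charFun ?_
  rw [ProbabilityTheory.charFun_map_add_prod_eq_mul]
  ext u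
  simp only [Pi.mul_apply, charFun_map_smul, charFun_stdGaussian, ← Complex.exp_add, norm_smul]
  congr 1
  norm_cast
  have h1 := Real.sq_sqrt hs
  have h2 := Real.sq_sqrt ht
  have h3 := Real.sq_sqrt (add_nonneg hs ht)
  have h4 : ‖√s‖ ^ 2 = s := by rw [Real.norm_eq_abs, sq_abs, h1]
  have h5 : ‖√t‖ ^ 2 = t := by rw [Real.norm_eq_abs, sq_abs, h2]
  have h6 : ‖√(s + t)‖ ^ 2 = s + t := by rw [Real.norm_eq_abs, sq_abs, h3]
  norm_cast
  simp only [mul_pow, h4, h5, h6]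
  ring

/-- The Cameron-Martin formula. -/
theorem integral_stdGaussian_shift (f : G → ℝ) (a : G) :
    ∫ x, f x ∂(stdGaussian G) =
      ∫ x, f (x + a) * Real.exp (-⟪a, x⟫ - ‖a‖ ^ 2 / 2) ∂(stdGaussian G) := by
  rw [integral_stdGaussian_eq, integral_stdGaussian_eq, ← integral_add_right_eq_self _ a]
  congr 1
  ext x
  have : Real.exp (-‖x + a‖ ^ 2 / 2) =
      Real.exp (-‖x‖ ^ 2 / 2) * Real.exp (-⟪a, x⟫ - ‖a‖ ^ 2 / 2) := by
    rw [← Real.exp_add, norm_add_sq_real, real_inner_comm]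
    congr 1
    ring
  simp only [smul_eq_mul]
  rw [this]
  ring

theorem integrable_exp_mul_norm (K : ℝ) :
    Integrable (fun x : G => Real.exp (K * ‖x‖)) (stdGaussian G) := by
  obtain ⟨C, hC, hi⟩ := ProbabilityTheory.IsGaussian.exists_integrable_exp_sq (stdGaussian G)
  refine (hi.const_mul (Real.exp (K ^ 2 / (4 * C)))).mono' (by fun_prop)
    (Filter.Eventually.of_forall fun x => ?_)
  rw [Real.norm_eq_abs, Real.abs_exp, ← Real.exp_add]
  apply Real.exp_le_exp.mpr
  have h : K ^ 2 / (4 * C) + C * ‖x‖ ^ 2 - K * ‖x‖ = C * (‖x‖ - K / (2 * C)) ^ 2 := by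
    field_simp
    ring
  nlinarith [mul_nonneg hC.le (sq_nonneg (‖x‖ - K / (2 * C)))]

theorem integral_inner_stdGaussian (b : G) : ∫ x, ⟪b, x⟫ ∂(stdGaussian G) = 0 := by
  have h := integral_comp_of_comp_adjoint (G := G) (-LinearMap.id)
    (by ext x; simp) (φ := fun x => ⟪b, x⟫) (by fun_prop)
  simp only [LinearMap.neg_apply, LinearMap.id_apply, inner_neg_right, integral_neg] at h
  linarith

theorem integrable_inner_stdGaussian (b : G) : Integrable (fun x => ⟪b, x⟫) (stdGaussian G) := by
  refine ((integrable_exp_mul_norm (G := G) 1).const_mul ‖b‖).mono' (by fun_prop)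
    (Filter.Eventually.of_forall fun x => ?_)
  refine (abs_real_inner_le_norm b x).trans ?_
  gcongr
  linarith [Real.add_one_le_exp (1 * ‖x‖)]

end Gaussian

section Heat

variable {G : Type*} [NormedAddCommGroup G] [InnerProductSpace ℝ G]
  [FiniteDimensional ℝ G] [MeasurableSpace G] [BorelSpace G]

/-- The heat semigroup: convolution with the centered gaussian of variance `h`. -/
def heat (h : ℝ) (φ : G → ℝ) (y : G) : ℝ := ∫ z, φ (y + √h • z) ∂(stdGaussian G)

theorem integrable_of_forall_mem_Icc {φ : G → ℝ} {a b : ℝ} (hφ : Measurable φ)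
    (hab : ∀ y, φ y ∈ Set.Icc a b) {τ : G → G} (hτ : Measurable τ) :
    Integrable (fun z => φ (τ z)) (stdGaussian G) :=
  Integrable.of_mem_Icc a b (hφ.comp hτ).aemeasurable (Filter.Eventually.of_forall fun _ => hab _)

theorem measurable_heat {φ : G → ℝ} (hφ : Measurable φ) (h : ℝ) : Measurable (heat h φ) := by
  have : StronglyMeasurable (fun p : G × G => φ (p.1 + √h • p.2)) :=
    (hφ.comp (by fun_prop)).stronglyMeasurable
  exact (this.integral_prod_right (ν := stdGaussian G)).measurable

theorem heat_mem_Icc {φ : G → ℝ} {a b : ℝ} (hφ : Measurable φ)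
    (hab : ∀ y, φ y ∈ Set.Icc a b) (h : ℝ) (y : G) : heat h φ y ∈ Set.Icc a b := by
  have hi := integrable_of_forall_mem_Icc hφ hab (τ := fun z => y + √h • z) (by fun_prop)
  constructor
  · have := integral_mono (integrable_const a) hi (fun z => (hab (y + √h • z)).1)
    simpa [heat] using this
  · have := integral_mono hi (integrable_const b) (fun z => (hab (y + √h • z)).2)
    simpa [heat] using this

theorem heat_zero_one (φ : G → ℝ) : heat 1 φ 0 = ∫ z, φ z ∂(stdGaussian G) := by
  simp [heat]

theorem heat_heat {φ : G → ℝ} {a b : ℝ} (hφ : Measurable φ) (hab : ∀ y, φ y ∈ Set.Icc a b)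
    {s t : ℝ} (hs : 0 ≤ s) (ht : 0 ≤ t) (y : G) :
    heat s (heat t φ) y = heat (s + t) φ y := by
  have hm : Measurable fun z : G => φ (y + z) := hφ.comp (by fun_prop)
  have h1 : heat (s + t) φ y = ∫ z, φ (y + z) ∂((stdGaussian G).map (fun z => √(s + t) • z)) := by
    rw [integral_map (by fun_prop) hm.aestronglyMeasurable, heat]
  rw [h1, ← map_prod_stdGaussian s t hs ht, integral_map (by fun_prop) hm.aestronglyMeasurable,
    integral_prod]
  · simp only [heat, add_assoc]
  · exact Integrable.of_mem_Icc a b (hm.comp (by fun_prop)).aemeasurable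
      (Filter.Eventually.of_forall fun _ => hab _)

/-- A Lipschitz function with a measurable first-order expansion, with quadratic error,
uniformly over the base point. -/
structure QuadExpansion (Λ : ℝ) (φ : G → ℝ) (g : G → G) : Prop where
  measurable : Measurable φ
  measurable_grad : Measurable g
  lipschitz : ∀ y z, |φ (y + z) - φ y| ≤ Λ * ‖z‖
  norm_grad_le : ∀ y, ‖g y‖ ≤ Λ
  expansion : ∀ y z, |φ (y + z) - φ y - ⟪g y, z⟫| ≤ Λ * ‖z‖ ^ 2

omit [FiniteDimensional ℝ G] [BorelSpace G] in
theorem QuadExpansion.nonneg {Λ : ℝ} {φ : G → ℝ} {g : G → G} (H : QuadExpansion Λ φ g) : 0 ≤ Λ :=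
  (norm_nonneg _).trans (H.norm_grad_le 0)

theorem norm_integral_stdGaussian_le {X : Type*} [NormedAddCommGroup X] [NormedSpace ℝ X]
    {F : G → X} {C : ℝ} (hF : ∀ z, ‖F z‖ ≤ C) : ‖∫ z, F z ∂(stdGaussian G)‖ ≤ C := by
  have := norm_integral_le_of_norm_le_const (μ := stdGaussian G) (Filter.Eventually.of_forall hF)
  simpa using this

theorem QuadExpansion.heat {Λ a b : ℝ} {φ : G → ℝ} {g : G → G} (H : QuadExpansion Λ φ g)
    (hab : ∀ y, φ y ∈ Set.Icc a b) (h : ℝ) :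
    QuadExpansion Λ (heat h φ) (fun y => ∫ z, g (y + √h • z) ∂(stdGaussian G)) := by
  have hg := H.measurable_grad
  have hi : ∀ y : G, Integrable (fun z => φ (y + √h • z)) (stdGaussian G) := fun y =>
    integrable_of_forall_mem_Icc H.measurable hab (by fun_prop)
  have hgi : ∀ y : G, Integrable (fun z => g (y + √h • z)) (stdGaussian G) := fun y =>
    Integrable.of_bound (C := Λ) (hg.comp (by fun_prop)).aestronglyMeasurable
      (Filter.Eventually.of_forall fun _ => H.norm_grad_le _)
  refine ⟨measurable_heat H.measurable h, ?_, fun y z => ?_, fun y => ?_, fun y z => ?_⟩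
  · have : StronglyMeasurable (fun p : G × G => g (p.1 + √h • p.2)) :=
      (hg.comp (by fun_prop)).stronglyMeasurable
    exact (this.integral_prod_right (ν := stdGaussian G)).measurable
  · rw [FRBL.heat, FRBL.heat, ← integral_sub (hi _) (hi _)]
    rw [← Real.norm_eq_abs]
    refine norm_integral_stdGaussian_le fun x => ?_
    rw [add_right_comm]
    exact H.lipschitz _ _
  · exact norm_integral_stdGaussian_le fun x => H.norm_grad_le _
  · have e : ⟪∫ x, g (y + √h • x) ∂(stdGaussian G), z⟫ =
        ∫ x, ⟪g (y + √h • x), z⟫ ∂(stdGaussian G) := by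
      rw [real_inner_comm, ← integral_inner (hgi y)]
      simp_rw [real_inner_comm z]
    rw [FRBL.heat, FRBL.heat, e, ← integral_sub (hi _) (hi _), ← integral_sub]
    · rw [← Real.norm_eq_abs]
      refine norm_integral_stdGaussian_le fun x => ?_
      rw [add_right_comm]
      exact H.expansion _ _
    · exact (hi _).sub (hi _)
    · exact (hgi y).inner_const z

omit [FiniteDimensional ℝ G] in
theorem QuadExpansion.comp {Λ A B K : ℝ} {φ : G → ℝ} {g : G → G} (H : QuadExpansion Λ φ g)
    (hAB : ∀ y, φ y ∈ Set.Icc A B) {ψ ψ' : ℝ → ℝ} (hψ : Measurable ψ) (hψ' : Measurable ψ')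
    (hK : 0 ≤ K)
    (hlip : ∀ r ∈ Set.Icc A B, ∀ r' ∈ Set.Icc A B, |ψ r' - ψ r| ≤ K * |r' - r|)
    (hbd : ∀ r ∈ Set.Icc A B, |ψ' r| ≤ K)
    (hquad : ∀ r ∈ Set.Icc A B, ∀ r' ∈ Set.Icc A B,
      |ψ r' - ψ r - ψ' r * (r' - r)| ≤ K * (r' - r) ^ 2) :
    QuadExpansion (K * (Λ + Λ ^ 2)) (fun y => ψ (φ y)) (fun y => ψ' (φ y) • g y) := by
  have hΛ := H.nonneg
  have hm := H.measurable
  have hg := H.measurable_grad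
  refine ⟨hψ.comp hm, (hψ'.comp hm).smul hg, fun y z => ?_, fun y => ?_, fun y z => ?_⟩
  · calc _ ≤ K * |φ (y + z) - φ y| := hlip _ (hAB _) _ (hAB _)
      _ ≤ K * (Λ * ‖z‖) := by gcongr; exact H.lipschitz y z
      _ ≤ K * ((Λ + Λ ^ 2) * ‖z‖) := by gcongr; nlinarith
      _ = _ := by ring
  · rw [norm_smul]
    calc _ ≤ K * Λ := mul_le_mul (hbd _ (hAB _)) (H.norm_grad_le y) (norm_nonneg _) hK
      _ ≤ _ := by gcongr; nlinarith
  · have h1 := hquad _ (hAB y) _ (hAB (y + z))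
    have h2 : (φ (y + z) - φ y) ^ 2 ≤ (Λ * ‖z‖) ^ 2 := by
      rw [← sq_abs]
      gcongr
      exact H.lipschitz y z
    have h3 : |ψ' (φ y) * (φ (y + z) - φ y - ⟪g y, z⟫)| ≤ K * (Λ * ‖z‖ ^ 2) := by
      rw [abs_mul]
      exact mul_le_mul (hbd _ (hAB _)) (H.expansion y z) (abs_nonneg _) hK
    have e : ψ (φ (y + z)) - ψ (φ y) - ⟪ψ' (φ y) • g y, z⟫ =
        (ψ (φ (y + z)) - ψ (φ y) - ψ' (φ y) * (φ (y + z) - φ y)) +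
          ψ' (φ y) * (φ (y + z) - φ y - ⟪g y, z⟫) := by
      rw [real_inner_smul_left]; ring
    rw [e]
    refine (abs_add_le _ _).trans ((add_le_add h1 h3).trans ?_)
    have := mul_le_mul_of_nonneg_left h2 hK
    nlinarith

omit [FiniteDimensional ℝ G] in
theorem QuadExpansion.log {Λ a b : ℝ} (ha : 0 < a) {φ : G → ℝ} {g : G → G}
    (H : QuadExpansion Λ φ g) (hab : ∀ y, φ y ∈ Set.Icc a b) :
    QuadExpansion ((a⁻¹ + a⁻¹ ^ 2) * (Λ + Λ ^ 2)) (fun y => Real.log (φ y))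
      (fun y => (φ y)⁻¹ • g y) := by
  have hinv : ∀ r ∈ Set.Icc a b, r⁻¹ ≤ a⁻¹ := fun r hr => inv_anti₀ ha hr.1
  have key : ∀ r ∈ Set.Icc a b, ∀ r' ∈ Set.Icc a b, Real.log r' - Real.log r ≤ r⁻¹ * (r' - r) := by
    intro r hr r' hr'
    have hr0 : 0 < r := ha.trans_le hr.1
    have hr0' : 0 < r' := ha.trans_le hr'.1
    rw [← Real.log_div hr0'.ne' hr0.ne']
    refine (Real.log_le_sub_one_of_pos (by positivity)).trans (le_of_eq ?_)
    field_simp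
  refine H.comp hab Real.measurable_log measurable_inv (by positivity) ?_ ?_ ?_
  · intro r hr r' hr'
    have hr0 : 0 < r := ha.trans_le hr.1
    have hr0' : 0 < r' := ha.trans_le hr'.1
    have h1 := key r hr r' hr'
    have h2 := key r' hr' r hr
    have a1 : r⁻¹ * (r' - r) ≤ a⁻¹ * |r' - r| :=
      (mul_le_mul_of_nonneg_left (le_abs_self _) (by positivity)).trans
        (mul_le_mul_of_nonneg_right (hinv r hr) (abs_nonneg _))
    have a2 : r'⁻¹ * (r - r') ≤ a⁻¹ * |r' - r| := by
      rw [abs_sub_comm]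
      exact (mul_le_mul_of_nonneg_left (le_abs_self _) (by positivity)).trans
        (mul_le_mul_of_nonneg_right (hinv r' hr') (abs_nonneg _))
    have a3 : 0 ≤ a⁻¹ ^ 2 * |r' - r| := by positivity
    rw [abs_le]
    constructor <;> nlinarith
  · intro r hr
    have hr0 : 0 < r := ha.trans_le hr.1
    rw [abs_of_pos (by positivity)]
    have := hinv r hr
    nlinarith [sq_nonneg a⁻¹]
  · intro r hr r' hr'
    have hr0 : 0 < r := ha.trans_le hr.1
    have hr0' : 0 < r' := ha.trans_le hr'.1
    have h1 := key r hr r' hr'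
    have h2 := key r' hr' r hr
    have e : r'⁻¹ * (r - r') = r⁻¹ * (r - r') + r⁻¹ * r'⁻¹ * (r' - r) ^ 2 := by
      field_simp
      ring
    have h3 : r⁻¹ * r'⁻¹ * (r' - r) ^ 2 ≤ a⁻¹ ^ 2 * (r' - r) ^ 2 := by
      rw [pow_two a⁻¹]
      exact mul_le_mul_of_nonneg_right (mul_le_mul (hinv r hr) (hinv r' hr') (by positivity)
        (by positivity)) (sq_nonneg _)
    have h4 : 0 ≤ a⁻¹ * (r' - r) ^ 2 := by positivity
    have h5 : 0 ≤ a⁻¹ ^ 2 * (r' - r) ^ 2 := by positivity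
    rw [abs_le]
    constructor <;> nlinarith

omit [FiniteDimensional ℝ G] in
theorem QuadExpansion.exp {Λ A B : ℝ} {φ : G → ℝ} {g : G → G}
    (H : QuadExpansion Λ φ g) (hAB : ∀ y, φ y ∈ Set.Icc A B) :
    QuadExpansion (Real.exp B * (Λ + Λ ^ 2)) (fun y => Real.exp (φ y))
      (fun y => Real.exp (φ y) • g y) := by
  have key : ∀ r r' : ℝ, Real.exp r * (r' - r) ≤ Real.exp r' - Real.exp r := by
    intro r r'
    have h1 := Real.add_one_le_exp (r' - r)
    have h2 : Real.exp r' = Real.exp r * Real.exp (r' - r) := by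
      rw [← Real.exp_add]; congr 1; ring
    nlinarith [Real.exp_pos r]
  have hle : ∀ r ∈ Set.Icc A B, Real.exp r ≤ Real.exp B := fun r hr => Real.exp_le_exp.mpr hr.2
  have hlip : ∀ r ∈ Set.Icc A B, ∀ r' ∈ Set.Icc A B,
      |Real.exp r' - Real.exp r| ≤ Real.exp B * |r' - r| := by
    intro r hr r' hr'
    have a1 : Real.exp r * (r - r') ≤ Real.exp B * |r' - r| := by
      rw [abs_sub_comm]
      exact (mul_le_mul_of_nonneg_left (le_abs_self _) (by positivity)).trans
        (mul_le_mul_of_nonneg_right (hle r hr) (abs_nonneg _))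
    have a2 : Real.exp r' * (r' - r) ≤ Real.exp B * |r' - r| :=
      (mul_le_mul_of_nonneg_left (le_abs_self _) (by positivity)).trans
        (mul_le_mul_of_nonneg_right (hle r' hr') (abs_nonneg _))
    have h1 := key r r'
    have h2 := key r' r
    rw [abs_le]
    constructor <;> linarith
  refine H.comp hAB Real.measurable_exp Real.measurable_exp (by positivity) hlip ?_ ?_
  · intro r hr
    rw [Real.abs_exp]
    exact hle r hr
  · intro r hr r' hr'
    have h1 := key r r'
    have h2 := key r' r
    have h3 : (Real.exp r' - Real.exp r) * (r' - r) ≤ Real.exp B * (r' - r) ^ 2 := by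
      calc _ ≤ |(Real.exp r' - Real.exp r) * (r' - r)| := le_abs_self _
        _ = |Real.exp r' - Real.exp r| * |r' - r| := abs_mul _ _
        _ ≤ (Real.exp B * |r' - r|) * |r' - r| := by gcongr; exact hlip r hr r' hr'
        _ = _ := by rw [mul_assoc, ← sq, sq_abs]
    rw [abs_of_nonneg (by linarith)]
    nlinarith

theorem exp_sub_one_sub_le (t : ℝ) : |Real.exp t - 1 - t| ≤ t ^ 2 * Real.exp |t| := by
  have h1 := Real.add_one_le_exp t
  have h2 := Real.add_one_le_exp (-t)
  have h3 : Real.exp t * Real.exp (-t) = 1 := by rw [← Real.exp_add]; simp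
  have h4 := Real.exp_pos t
  rw [abs_of_nonneg (by linarith)]
  have h5 : Real.exp t - 1 ≤ t * Real.exp t := by nlinarith
  rcases le_total 0 t with ht | ht
  · rw [abs_of_nonneg ht]
    nlinarith
  · rw [abs_of_nonpos ht]
    have h6 : 1 ≤ Real.exp (-t) := Real.one_le_exp (by linarith)
    nlinarith [sq_nonneg t]

theorem sq_le_two_mul_exp {p : ℝ} (hp : 0 ≤ p) : p ^ 2 ≤ 2 * Real.exp p := by
  have := Real.quadratic_le_exp_of_nonneg hp
  linarith

end Heat

section Estimates

variable {G : Type*} [NormedAddCommGroup G] [InnerProductSpace ℝ G]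
  [FiniteDimensional ℝ G] [MeasurableSpace G] [BorelSpace G]

omit [FiniteDimensional ℝ G] [MeasurableSpace G] [BorelSpace G] in
theorem abs_exp_inner_sub_le {a : G} (ha : ‖a‖ ≤ 1) (x : G) :
    |Real.exp (⟪a, x⟫ - ‖a‖ ^ 2 / 2) - 1 - ⟪a, x⟫| ≤
      ‖a‖ ^ 2 * (3 * Real.exp (2 * (‖x‖ + 1))) := by
  set t := ⟪a, x⟫ - ‖a‖ ^ 2 / 2 with ht
  have h0 := norm_nonneg a
  have hx := norm_nonneg x
  have h1 : |t| ≤ ‖a‖ * (‖x‖ + 1) := by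
    have h2 := abs_real_inner_le_norm a x
    have h3 : |t| ≤ |⟪a, x⟫| + |‖a‖ ^ 2 / 2| := abs_sub _ _
    rw [abs_of_nonneg (a := ‖a‖ ^ 2 / 2) (by positivity)] at h3
    nlinarith
  have h1' : |t| ≤ ‖x‖ + 1 := h1.trans (by nlinarith)
  have h2 := exp_sub_one_sub_le t
  have h3 : t ^ 2 * Real.exp |t| ≤ (‖a‖ * (‖x‖ + 1)) ^ 2 * Real.exp (‖x‖ + 1) := by
    rw [← sq_abs t]
    gcongr
  have h4 := sq_le_two_mul_exp (p := ‖x‖ + 1) (by positivity)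
  have h5 : Real.exp (2 * (‖x‖ + 1)) = Real.exp (‖x‖ + 1) * Real.exp (‖x‖ + 1) := by
    rw [← Real.exp_add]; ring_nf
  have h6 : (‖a‖ * (‖x‖ + 1)) ^ 2 * Real.exp (‖x‖ + 1) ≤
      ‖a‖ ^ 2 * (2 * Real.exp (2 * (‖x‖ + 1))) := by
    rw [h5, mul_pow, mul_assoc, ← mul_assoc 2]
    gcongr
  have h7 : 1 ≤ Real.exp (2 * (‖x‖ + 1)) := Real.one_le_exp (by positivity)
  have e : Real.exp t - 1 - ⟪a, x⟫ = (Real.exp t - 1 - t) - ‖a‖ ^ 2 / 2 := by rw [ht]; ring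
  rw [e]
  have h8 := abs_sub (Real.exp t - 1 - t) (‖a‖ ^ 2 / 2)
  rw [abs_of_nonneg (a := ‖a‖ ^ 2 / 2) (by positivity)] at h8
  nlinarith [sq_nonneg ‖a‖]

/-- The heat semigroup maps bounded functions to functions with quadratic expansions. -/
theorem exists_quadExpansion_heat {φ : G → ℝ} {A B s : ℝ} (hφ : Measurable φ)
    (hAB : ∀ y, φ y ∈ Set.Icc A B) (hs : 0 < s) :
    ∃ Λ g, QuadExpansion Λ (heat s φ) g := by
  obtain ⟨L, hL0, hL⟩ : ∃ L, 0 ≤ L ∧ ∀ y, |φ y| ≤ L :=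
    ⟨max |A| |B|, by positivity, fun y => abs_le_max_abs_abs (hAB y).1 (hAB y).2⟩
  set σ := √s with hσ
  have hσ0 : 0 < σ := Real.sqrt_pos.mpr hs
  set J : G → ℝ := fun x => 3 * Real.exp (2 * (‖x‖ + 1)) with hJ
  have hJi : Integrable J (stdGaussian G) := by
    refine ((integrable_exp_mul_norm (G := G) 2).const_mul (3 * Real.exp 2)).congr
      (Filter.Eventually.of_forall fun x => ?_)
    simp only [hJ]
    rw [mul_assoc, ← Real.exp_add]
    ring_nf
  have hJ0 : ∀ x, 0 ≤ J x := fun x => by positivity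
  have hJn : ∀ x, ‖x‖ ≤ J x := fun x => by
    have := Real.add_one_le_exp (2 * (‖x‖ + 1))
    simp only [hJ]
    nlinarith [norm_nonneg x]
  set C := ∫ x, J x ∂(stdGaussian G) with hC
  have hC0 : 0 ≤ C := integral_nonneg hJ0
  have hmeas : ∀ y : G, Measurable fun x => φ (y + σ • x) := fun y => hφ.comp (by fun_prop)
  have h_int : ∀ (y : G), Integrable (fun x => φ (y + σ • x)) (stdGaussian G) := fun y =>
    integrable_of_forall_mem_Icc hφ hAB (by fun_prop)
  have hid : Integrable (fun x : G => x) (stdGaussian G) :=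
    hJi.mono' (by fun_prop) (Filter.Eventually.of_forall hJn)
  have hvec : ∀ y : G, Integrable (fun x => φ (y + σ • x) • x) (stdGaussian G) := fun y => by
    refine (hJi.const_mul L).mono' ((hmeas y).smul measurable_id).aestronglyMeasurable
      (Filter.Eventually.of_forall fun x => ?_)
    rw [norm_smul]
    exact mul_le_mul (hL _) (hJn x) (norm_nonneg _) hL0
  set g : G → G := fun y => σ⁻¹ • ∫ x, φ (y + σ • x) • x ∂(stdGaussian G) with hg
  have hint_inner : ∀ y a : G, Integrable (fun x => φ (y + σ • x) * ⟪a, x⟫) (stdGaussian G) :=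
    fun y a => by
      refine ((hvec y).const_inner a).congr (Filter.Eventually.of_forall fun x => ?_)
      simp only [real_inner_smul_right]
  have hgz : ∀ y a : G, ⟪g y, σ • a⟫ = ∫ x, φ (y + σ • x) * ⟪a, x⟫ ∂(stdGaussian G) := by
    intro y a
    rw [hg, real_inner_smul_left, real_inner_smul_right, ← mul_assoc, inv_mul_cancel₀ hσ0.ne',
      one_mul, real_inner_comm, ← integral_inner (hvec y)]
    simp only [real_inner_smul_right]
  have hgn : ∀ y, ‖g y‖ ≤ σ⁻¹ * (L * C) := by
    intro y
    rw [hg, norm_smul, Real.norm_of_nonneg (by positivity)]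
    gcongr
    rw [hC, ← integral_const_mul]
    refine norm_integral_le_of_norm_le (hJi.const_mul L) (Filter.Eventually.of_forall fun x => ?_)
    rw [norm_smul]
    exact mul_le_mul (hL _) (hJn x) (norm_nonneg _) hL0
  have hgi : ∀ y a, |⟪g y, σ • a⟫| ≤ L * C * ‖a‖ := by
    intro y a
    refine (abs_real_inner_le_norm _ _).trans ?_
    rw [norm_smul σ a, Real.norm_of_nonneg hσ0.le]
    calc _ ≤ (σ⁻¹ * (L * C)) * (σ * ‖a‖) := by gcongr; exact hgn y
      _ = _ := by field_simp
  have hshift : ∀ y a, heat s φ (y + σ • a) =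
      ∫ x, φ (y + σ • x) * Real.exp (⟪a, x⟫ - ‖a‖ ^ 2 / 2) ∂(stdGaussian G) := by
    intro y a
    rw [heat, integral_stdGaussian_shift _ (-a)]
    refine integral_congr_ae (Filter.Eventually.of_forall fun x => ?_)
    simp only [inner_neg_left, neg_neg, norm_neg]
    congr 2
    rw [smul_add, smul_neg]
    abel
  have hheat : ∀ y, |heat s φ y| ≤ L := fun y => by
    rw [← Real.norm_eq_abs]
    exact norm_integral_stdGaussian_le fun z => hL _
  set D := 2 * L + 2 * (L * C) with hD
  have hD0 : 0 ≤ D := by positivity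
  have hsmall : ∀ y a, ‖a‖ ≤ 1 →
      |heat s φ (y + σ • a) - heat s φ y - ⟪g y, σ • a⟫| ≤ L * C * ‖a‖ ^ 2 := by
    intro y a ha
    have hexp : Integrable (fun x => φ (y + σ • x) * Real.exp (⟪a, x⟫ - ‖a‖ ^ 2 / 2))
        (stdGaussian G) := by
      refine ((integrable_exp_mul_norm (G := G) 1).const_mul L).mono'
        ((hmeas y).mul (by fun_prop)).aestronglyMeasurable
        (Filter.Eventually.of_forall fun x => ?_)
      rw [norm_mul, Real.norm_eq_abs, Real.norm_eq_abs, Real.abs_exp]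
      refine mul_le_mul (hL _) (Real.exp_le_exp.mpr ?_) (Real.exp_pos _).le hL0
      have := real_inner_le_norm a x
      nlinarith [sq_nonneg ‖a‖, norm_nonneg x]
    have e : heat s φ (y + σ • a) - heat s φ y - ⟪g y, σ • a⟫ =
        ∫ x, φ (y + σ • x) * (Real.exp (⟪a, x⟫ - ‖a‖ ^ 2 / 2) - 1 - ⟪a, x⟫) ∂(stdGaussian G) := by
      have hsub : Integrable (fun x => φ (y + σ • x) * Real.exp (⟪a, x⟫ - ‖a‖ ^ 2 / 2) -
          φ (y + σ • x)) (stdGaussian G) := hexp.sub (h_int y)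
      rw [hshift, hgz, heat, ← hσ, ← integral_sub hexp (h_int y),
        ← integral_sub hsub (hint_inner y a)]
      refine integral_congr_ae (Filter.Eventually.of_forall fun x => ?_)
      ring
    rw [e, ← Real.norm_eq_abs, show L * C * ‖a‖ ^ 2 = ∫ x, L * ‖a‖ ^ 2 * J x ∂(stdGaussian G) by
      rw [integral_const_mul]; ring]
    refine norm_integral_le_of_norm_le (hJi.const_mul _) (Filter.Eventually.of_forall fun x => ?_)
    rw [norm_mul, mul_assoc]
    exact mul_le_mul (hL _) (abs_exp_inner_sub_le ha x) (norm_nonneg _) hL0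
  have htriv : ∀ y y', |heat s φ y' - heat s φ y| ≤ 2 * L := fun y y' => by
    have := abs_sub (heat s φ y') (heat s φ y)
    linarith [hheat y, hheat y']
  have hLC : 0 ≤ L * C := by positivity
  have hlip : ∀ y a, |heat s φ (y + σ • a) - heat s φ y| ≤ D * ‖a‖ := by
    intro y a
    rcases le_total ‖a‖ 1 with ha | ha
    · have h1 := hsmall y a ha
      have h2 := hgi y a
      have h3 := abs_add_le (heat s φ (y + σ • a) - heat s φ y - ⟪g y, σ • a⟫) ⟪g y, σ • a⟫
      rw [sub_add_cancel] at h3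
      have h4 : ‖a‖ ^ 2 ≤ ‖a‖ := by nlinarith [norm_nonneg a]
      nlinarith [norm_nonneg a, mul_le_mul_of_nonneg_left h4 hLC, mul_nonneg hL0 (norm_nonneg a)]
    · have := htriv y (y + σ • a)
      nlinarith
  have hquad : ∀ y a, |heat s φ (y + σ • a) - heat s φ y - ⟪g y, σ • a⟫| ≤ D * ‖a‖ ^ 2 := by
    intro y a
    rcases le_total ‖a‖ 1 with ha | ha
    · have h1 := hsmall y a ha
      nlinarith [sq_nonneg ‖a‖, mul_nonneg hL0 (sq_nonneg ‖a‖), mul_nonneg hLC (sq_nonneg ‖a‖)]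
    · have h1 := htriv y (y + σ • a)
      have h2 := hgi y a
      have h3 := abs_sub (heat s φ (y + σ • a) - heat s φ y) ⟪g y, σ • a⟫
      have h4 : ‖a‖ ≤ ‖a‖ ^ 2 := by nlinarith
      have h5 : 1 ≤ ‖a‖ ^ 2 := by nlinarith
      nlinarith [mul_le_mul_of_nonneg_left h4 hLC, mul_le_mul_of_nonneg_left h5 hL0]
  have hz : ∀ z : G, σ • (σ⁻¹ • z) = z := fun z => by
    rw [smul_smul, mul_inv_cancel₀ hσ0.ne', one_smul]
  have hzn : ∀ z : G, ‖σ⁻¹ • z‖ = σ⁻¹ * ‖z‖ := fun z => by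
    rw [norm_smul, Real.norm_of_nonneg (by positivity)]
  refine ⟨D * (σ⁻¹ + σ⁻¹ ^ 2), g, measurable_heat hφ s, ?_, fun y z => ?_, fun y => ?_,
    fun y z => ?_⟩
  · have : StronglyMeasurable (fun p : G × G => φ (p.1 + σ • p.2) • p.2) :=
      ((hφ.comp (by fun_prop)).smul measurable_snd).stronglyMeasurable
    exact (this.integral_prod_right (ν := stdGaussian G)).measurable.const_smul _
  · have := hlip y (σ⁻¹ • z)
    rw [hz, hzn] at this
    refine this.trans ?_
    rw [mul_assoc]
    gcongr
    nlinarith [sq_nonneg σ⁻¹]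
  · refine (hgn y).trans ?_
    have h1 : L * C ≤ D := by linarith
    have h2 : 0 ≤ D * σ⁻¹ ^ 2 := by positivity
    have h3 := mul_le_mul_of_nonneg_left h1 (inv_nonneg.mpr hσ0.le)
    linarith
  · have := hquad y (σ⁻¹ • z)
    rw [hz, hzn] at this
    refine this.trans ?_
    rw [mul_assoc, mul_pow]
    gcongr
    have : 0 ≤ σ⁻¹ := by positivity
    linarith

theorem integral_le_log_integral_exp {Ω : Type*} [MeasurableSpace Ω] {μ : Measure Ω}
    [IsProbabilityMeasure μ] {R : Ω → ℝ}
    (hR : Integrable R μ) (hexp : Integrable (fun x => Real.exp (R x)) μ) :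
    ∫ x, R x ∂μ ≤ Real.log (∫ x, Real.exp (R x) ∂μ) := by
  set m := ∫ x, R x ∂μ with hm
  have hsub : Integrable (fun x => R x - m) μ := hR.sub (integrable_const m)
  have h1 : ∫ x, Real.exp m * (R x - m + 1) ∂μ ≤ ∫ x, Real.exp (R x) ∂μ := by
    refine integral_mono ((hsub.add (integrable_const 1)).const_mul _) hexp fun x => ?_
    have h2 := Real.add_one_le_exp (R x - m)
    have h3 : Real.exp (R x) = Real.exp m * Real.exp (R x - m) := by
      rw [← Real.exp_add]; congr 1; ring
    rw [h3]
    gcongr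
  rw [integral_const_mul, integral_add hsub (integrable_const 1),
    integral_sub hR (integrable_const m), ← hm] at h1
  simp only [integral_const, probReal_univ, smul_eq_mul, one_mul, sub_self, zero_add,
    mul_one] at h1
  have := Real.log_le_log (Real.exp_pos m) h1
  rwa [Real.log_exp] at this

/-- Lower bound for the heat semigroup in terms of an arbitrary constant drift. -/
theorem integral_log_sub_le_log_heat {ψ : G → ℝ} {a b : ℝ} (ha : 0 < a) (hψ : Measurable ψ)
    (hab : ∀ y, ψ y ∈ Set.Icc a b) {h : ℝ} (hh : 0 ≤ h) (y w : G) :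
    ∫ z, Real.log (ψ (y + √h • z + h • w)) ∂(stdGaussian G) - h * ‖w‖ ^ 2 / 2 ≤
      Real.log (heat h ψ y) := by
  have hsq : √h * √h = h := Real.mul_self_sqrt hh
  have hlogab : ∀ y, Real.log (ψ y) ∈ Set.Icc (Real.log a) (Real.log b) := fun y =>
    ⟨Real.log_le_log ha (hab y).1, Real.log_le_log (ha.trans_le (hab y).1) (hab y).2⟩
  have hlog : Measurable fun y => Real.log (ψ y) := Real.measurable_log.comp hψ
  have hi := integrable_of_forall_mem_Icc hlog hlogab (τ := fun z => y + √h • z + h • w)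
    (by fun_prop)
  have hin := integrable_inner_stdGaussian (√h • w)
  set R : G → ℝ := fun z =>
    Real.log (ψ (y + √h • z + h • w)) - ⟪√h • w, z⟫ - ‖√h • w‖ ^ 2 / 2 with hRdef
  have hR : Integrable R (stdGaussian G) := (hi.sub hin).sub (integrable_const _)
  have hexpR : ∀ z, Real.exp (R z) =
      ψ (y + √h • (z + √h • w)) * Real.exp (-⟪√h • w, z⟫ - ‖√h • w‖ ^ 2 / 2) := by
    intro z
    have e : y + √h • (z + √h • w) = y + √h • z + h • w := by
      rw [smul_add, smul_smul, hsq, add_assoc]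
    rw [e, hRdef]
    simp only
    rw [sub_sub, Real.exp_sub, Real.exp_log (ha.trans_le (hab _).1), div_eq_mul_inv, ← Real.exp_neg]
    congr 2
    ring
  have hexp : Integrable (fun z => Real.exp (R z)) (stdGaussian G) := by
    refine ((integrable_exp_mul_norm (G := G) ‖√h • w‖).const_mul b).mono' (by fun_prop)
      (Filter.Eventually.of_forall fun z => ?_)
    rw [Real.norm_eq_abs, Real.abs_exp, hexpR]
    have h0 : 0 < ψ (y + √h • (z + √h • w)) := ha.trans_le (hab _).1
    refine mul_le_mul (hab _).2 (Real.exp_le_exp.mpr ?_) (Real.exp_pos _).le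
      (h0.le.trans (hab _).2)
    have := abs_real_inner_le_norm (√h • w) z
    have := neg_abs_le ⟪√h • w, z⟫
    nlinarith [sq_nonneg ‖√h • w‖]
  have key := integral_le_log_integral_exp hR hexp
  simp_rw [hexpR] at key
  rw [← integral_stdGaussian_shift (fun x => ψ (y + √h • x))] at key
  have e : ∫ z, R z ∂(stdGaussian G) =
      ∫ z, Real.log (ψ (y + √h • z + h • w)) ∂(stdGaussian G) - h * ‖w‖ ^ 2 / 2 := by
    have hsub : Integrable (fun z => Real.log (ψ (y + √h • z + h • w)) - ⟪√h • w, z⟫)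
        (stdGaussian G) := hi.sub hin
    simp only [hRdef]
    rw [integral_sub hsub (integrable_const _), integral_sub hi hin,
      integral_inner_stdGaussian, norm_smul, mul_pow, Real.norm_eq_abs, sq_abs, Real.sq_sqrt hh]
    simp
  rw [← e]
  exact key

/-- Upper bound for the heat semigroup in terms of the gradient drift, up to a second-order
error in the time step. -/
theorem exists_log_integral_exp_le (Λ A B : ℝ) : ∃ C, 0 ≤ C ∧ ∀ (u : G → ℝ) (g : G → G),
    QuadExpansion Λ u g → (∀ y, u y ∈ Set.Icc A B) → ∀ h ∈ Set.Icc (0 : ℝ) 1, ∀ y,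
    Real.log (∫ z, Real.exp (u (y + √h • z)) ∂(stdGaussian G)) ≤
      ∫ z, u (y + √h • z + h • g y) ∂(stdGaussian G) - h * ‖g y‖ ^ 2 / 2 + C * h ^ 2 := by
  set K := Λ + Λ ^ 2 with hK
  set K₂ := 2 * Λ + Λ ^ 2 with hK₂
  set J : G → ℝ := fun z => 4 * K ^ 2 * Real.exp ((K₂ + 2) * (‖z‖ + Λ + 1)) with hJ
  have hJi : Integrable J (stdGaussian G) := by
    refine ((integrable_exp_mul_norm (G := G) (K₂ + 2)).const_mul
      (4 * K ^ 2 * Real.exp ((K₂ + 2) * (Λ + 1)))).congr (Filter.Eventually.of_forall fun x => ?_)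
    simp only [hJ]
    rw [mul_assoc, ← Real.exp_add]
    ring_nf
  refine ⟨∫ z, J z ∂(stdGaussian G), integral_nonneg fun z => by positivity, ?_⟩
  intro u g H hAB h hh y
  obtain ⟨hh0, hh1⟩ := hh
  have hΛ := H.nonneg
  have hK0 : 0 ≤ K := by positivity
  have hsq : √h * √h = h := Real.mul_self_sqrt hh0
  have hs0 : 0 ≤ √h := Real.sqrt_nonneg h
  have hs1 : √h ≤ 1 := Real.sqrt_le_iff.mpr ⟨by norm_num, by simpa using hh1⟩
  have hhs : h ≤ √h := by nlinarith
  set b := g y with hb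
  have hbΛ : ‖b‖ ≤ Λ := H.norm_grad_le y
  have hb0 := norm_nonneg b
  have hu := H.measurable
  have hi := integrable_of_forall_mem_Icc hu hAB (τ := fun z => y + √h • z + h • b) (by fun_prop)
  have hin := integrable_inner_stdGaussian (√h • b)
  set R : G → ℝ := fun z => u (y + √h • z + h • b) - u y - ⟪√h • b, z⟫ - ‖√h • b‖ ^ 2 / 2
    with hRdef
  have hR : Integrable R (stdGaussian G) :=
    ((hi.sub (integrable_const _)).sub hin).sub (integrable_const _)
  have hnb : ‖√h • b‖ ^ 2 = h * ‖b‖ ^ 2 := by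
    rw [norm_smul, mul_pow, Real.norm_eq_abs, sq_abs, Real.sq_sqrt hh0]
  have hRbd : ∀ z, |R z| ≤ h * (K * (‖z‖ + Λ + 1) ^ 2) ∧ |R z| ≤ K₂ * (‖z‖ + Λ + 1) := by
    intro z
    have hz0 := norm_nonneg z
    set ζ := √h • z + h • b with hζ
    have hζn : ‖ζ‖ ≤ √h * (‖z‖ + Λ) := by
      refine (norm_add_le _ _).trans ?_
      rw [norm_smul, norm_smul, Real.norm_of_nonneg hs0, Real.norm_of_nonneg hh0]
      have := mul_le_mul hhs hbΛ hb0 hs0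
      linarith
    have hζ0 := norm_nonneg ζ
    have hζ1 : ‖ζ‖ ≤ ‖z‖ + Λ := hζn.trans (mul_le_of_le_one_left (by positivity) hs1)
    have hζ2 : ‖ζ‖ ^ 2 ≤ h * (‖z‖ + Λ) ^ 2 := by
      calc ‖ζ‖ ^ 2 ≤ (√h * (‖z‖ + Λ)) ^ 2 := by gcongr
        _ = _ := by rw [mul_pow, Real.sq_sqrt hh0]
    have hinner : ⟪b, ζ⟫ = ⟪√h • b, z⟫ + h * ‖b‖ ^ 2 := by
      rw [hζ, inner_add_right, real_inner_smul_right, real_inner_smul_right, real_inner_smul_left,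
        real_inner_self_eq_norm_sq]
    have e : R z = (u (y + ζ) - u y - ⟪b, ζ⟫) + h * ‖b‖ ^ 2 / 2 := by
      rw [hinner, hζ, ← add_assoc]
      simp only [hRdef, hnb]
      ring
    have h1 := H.expansion y ζ
    have h2 := H.lipschitz y ζ
    have h3 := abs_real_inner_le_norm b ζ
    have h4 : |u (y + ζ) - u y - ⟪b, ζ⟫| ≤ 2 * Λ * ‖ζ‖ := by
      refine (abs_sub _ _).trans ?_
      nlinarith
    have h5 : h * ‖b‖ ^ 2 / 2 ≤ h * Λ ^ 2 := by
      have : ‖b‖ ^ 2 ≤ Λ ^ 2 := by gcongr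
      nlinarith [mul_le_mul_of_nonneg_left this hh0, mul_nonneg hh0 (sq_nonneg Λ)]
    have h6 : |R z| ≤ |u (y + ζ) - u y - ⟪b, ζ⟫| + h * ‖b‖ ^ 2 / 2 := by
      rw [e]
      refine (abs_add_le _ _).trans (le_of_eq ?_)
      rw [abs_of_nonneg (a := h * ‖b‖ ^ 2 / 2) (by positivity)]
    constructor
    · refine (h6.trans (add_le_add h1 h5)).trans ?_
      have h7 : Λ * ‖ζ‖ ^ 2 ≤ Λ * (h * (‖z‖ + Λ + 1) ^ 2) := by
        refine mul_le_mul_of_nonneg_left (hζ2.trans (mul_le_mul_of_nonneg_left ?_ hh0)) hΛ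
        exact pow_le_pow_left₀ (by positivity) (by linarith) 2
      have h8 : (1 : ℝ) ≤ (‖z‖ + Λ + 1) ^ 2 := by nlinarith
      have h9 : h * Λ ^ 2 * 1 ≤ h * Λ ^ 2 * (‖z‖ + Λ + 1) ^ 2 := by gcongr
      rw [hK]
      linarith
    · refine (h6.trans (add_le_add h4 h5)).trans ?_
      have h7 : 2 * Λ * ‖ζ‖ ≤ 2 * Λ * (‖z‖ + Λ + 1) :=
        mul_le_mul_of_nonneg_left (by linarith) (by positivity)
      have h8 : h * Λ ^ 2 ≤ 1 * Λ ^ 2 := mul_le_mul_of_nonneg_right hh1 (sq_nonneg Λ)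
      have h9 : 1 * Λ ^ 2 ≤ (‖z‖ + Λ + 1) * Λ ^ 2 :=
        mul_le_mul_of_nonneg_right (by linarith) (sq_nonneg Λ)
      rw [hK₂]
      linarith
  have hexpR : ∀ z, Real.exp (u (y + √h • (z + √h • b))) *
      Real.exp (-⟪√h • b, z⟫ - ‖√h • b‖ ^ 2 / 2) = Real.exp (u y) * Real.exp (R z) := by
    intro z
    have e : y + √h • (z + √h • b) = y + √h • z + h • b := by
      rw [smul_add, smul_smul, hsq, add_assoc]
    rw [e, ← Real.exp_add, ← Real.exp_add]
    congr 1
    simp only [hRdef]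
    ring
  have hexp : Integrable (fun z => Real.exp (R z)) (stdGaussian G) := by
    refine ((integrable_exp_mul_norm (G := G) K₂).const_mul (Real.exp (K₂ * (Λ + 1)))).mono'
      (by fun_prop) (Filter.Eventually.of_forall fun z => ?_)
    rw [Real.norm_eq_abs, Real.abs_exp, ← Real.exp_add]
    refine Real.exp_le_exp.mpr ((le_abs_self _).trans ((hRbd z).2.trans (le_of_eq ?_)))
    ring
  have hpt : ∀ z, Real.exp (R z) ≤ 1 + R z + h ^ 2 * J z := by
    intro z
    obtain ⟨r1, r2⟩ := hRbd z
    set p := ‖z‖ + Λ + 1 with hp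
    have hp0 : 0 ≤ p := by positivity
    have h1 := (le_abs_self _).trans (exp_sub_one_sub_le (R z))
    have h2 : R z ^ 2 * Real.exp |R z| ≤ (h * (K * p ^ 2)) ^ 2 * Real.exp (K₂ * p) := by
      rw [← sq_abs (R z)]
      gcongr
    have h3 := sq_le_two_mul_exp hp0
    have h4 : (p ^ 2) ^ 2 ≤ (2 * Real.exp p) ^ 2 := by gcongr
    have h5 : J z = 4 * K ^ 2 * (Real.exp (K₂ * p) * Real.exp p ^ 2) := by
      simp only [hJ, ← hp]
      rw [← Real.exp_nat_mul, ← Real.exp_add]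
      ring_nf
    have h6 : (h * (K * p ^ 2)) ^ 2 * Real.exp (K₂ * p) ≤ h ^ 2 * J z := by
      rw [h5]
      calc _ = h ^ 2 * K ^ 2 * Real.exp (K₂ * p) * (p ^ 2) ^ 2 := by ring
        _ ≤ h ^ 2 * K ^ 2 * Real.exp (K₂ * p) * (2 * Real.exp p) ^ 2 := by gcongr
        _ = _ := by ring
    linarith
  have hpos : 0 < ∫ z, Real.exp (R z) ∂(stdGaussian G) := integral_exp_pos hexp
  have hRint : ∫ z, R z ∂(stdGaussian G) =
      ∫ z, u (y + √h • z + h • b) ∂(stdGaussian G) - u y - h * ‖b‖ ^ 2 / 2 := by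
    have hsub : Integrable (fun z => u (y + √h • z + h • b) - u y) (stdGaussian G) :=
      hi.sub (integrable_const _)
    have hsub' : Integrable (fun z => u (y + √h • z + h • b) - u y - ⟪√h • b, z⟫)
        (stdGaussian G) := hsub.sub hin
    simp only [hRdef]
    rw [integral_sub hsub' (integrable_const _), integral_sub hsub hin, integral_sub hi (integrable_const _),
      integral_inner_stdGaussian, hnb]
    simp
  have hupper : ∫ z, Real.exp (R z) ∂(stdGaussian G) ≤
      1 + ∫ z, R z ∂(stdGaussian G) + h ^ 2 * ∫ z, J z ∂(stdGaussian G) := by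
    have hadd : Integrable (fun z => 1 + R z) (stdGaussian G) := (integrable_const 1).add hR
    have : ∫ z, Real.exp (R z) ∂(stdGaussian G) ≤ ∫ z, (1 + R z + h ^ 2 * J z) ∂(stdGaussian G) :=
      integral_mono hexp (hadd.add (hJi.const_mul (h ^ 2))) hpt
    rw [integral_add hadd (hJi.const_mul (h ^ 2)),
      integral_add (integrable_const 1) hR, integral_const_mul] at this
    simpa using this
  rw [integral_stdGaussian_shift _ (√h • b)]
  simp_rw [hexpR]
  rw [integral_const_mul, Real.log_mul (Real.exp_pos _).ne' hpos.ne', Real.log_exp]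
  have := Real.log_le_sub_one_of_pos hpos
  linarith

end Estimates

section LinearAlgebra

variable {H : Type*} [NormedAddCommGroup H] [InnerProductSpace ℝ H] [FiniteDimensional ℝ H]

theorem finrank_le_posIndex {Q : H →ₗ[ℝ] H} {W : Submodule ℝ H}
    (hW : ∀ x ∈ W, x ≠ 0 → 0 < ⟪Q x, x⟫) : Module.finrank ℝ W ≤ posIndex Q :=
  le_csSup ⟨Module.finrank ℝ H, by rintro _ ⟨W, -, rfl⟩; exact W.finrank_le⟩ ⟨W, hW, rfl⟩

/-- If `Q` is positive definite on the kernel of `L` and its positive index is small enough, every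
element of the codomain has a preimage on which the quadratic form of `Q` is nonpositive. -/
theorem exists_apply_eq_and_inner_nonpos {Y : Type*} [AddCommGroup Y] [Module ℝ Y]
    [FiniteDimensional ℝ Y] {Q : H →ₗ[ℝ] H} (hQ : Q.IsSymmetric) (L : H →ₗ[ℝ] Y)
    (hker : ∀ x ∈ ker L, x ≠ 0 → 0 < ⟪Q x, x⟫)
    (hdim : posIndex Q + Module.finrank ℝ Y ≤ Module.finrank ℝ H) (y : Y) :
    ∃ w, L w = y ∧ ⟪Q w, w⟫ ≤ 0 := by
  set K := ker L with hK
  have hKle := finrank_le_posIndex hker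
  have hrank : Module.finrank ℝ (range L) + Module.finrank ℝ K = _ := L.finrank_range_add_finrank_ker
  have hrle := (range L).finrank_le
  have hKeq : Module.finrank ℝ K = posIndex Q := by omega
  have hrange : range L = ⊤ := Submodule.eq_top_of_finrank_eq (by omega)
  obtain ⟨w₀, hw₀⟩ := range_eq_top.mp hrange y
  have hproj : ∀ a, ∀ k ∈ K, ⟪K.starProjection a, k⟫ = ⟪a, k⟫ := fun a k hk => by
    have := (K.mem_orthogonal' _).mp (K.sub_starProjection_mem_orthogonal a) k hk
    rw [inner_sub_left] at this
    linarith
  set T : K →ₗ[ℝ] K := K.orthogonalProjectionOnto.toLinearMap ∘ₗ Q ∘ₗ K.subtype with hT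
  have hTinner : ∀ v k : K, ⟪(T v : H), k⟫ = ⟪Q v, k⟫ := fun v k => by
    simp [hT, hproj _ _ k.2]
  have hinj : Function.Injective T := by
    rw [← ker_eq_bot, ker_eq_bot']
    intro v hv
    by_contra hne
    have h1 := hker v v.2 (by simpa using hne)
    rw [← hTinner, hv] at h1
    simp at h1
  obtain ⟨v, hv⟩ := (injective_iff_surjective.mp hinj) (K.orthogonalProjectionOnto (Q w₀))
  have horth : ∀ k ∈ K, ⟪Q (w₀ - v), k⟫ = 0 := by
    intro k hk
    have h1 := hTinner v ⟨k, hk⟩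
    rw [hv] at h1
    rw [map_sub, inner_sub_left, ← h1]
    simp [hproj _ _ hk]
  refine ⟨w₀ - v, by rw [map_sub, hw₀, mem_ker.mp v.2, sub_zero], ?_⟩
  set w := w₀ - (v : H) with hw
  by_contra! hpos
  have hwK : w ∉ K := fun h => hpos.ne' (horth w h)
  have hW : ∀ x ∈ K ⊔ Submodule.span ℝ {w}, x ≠ 0 → 0 < ⟪Q x, x⟫ := by
    intro x hx hx0
    obtain ⟨k, hk, u, hu, rfl⟩ := Submodule.mem_sup.mp hx
    obtain ⟨t, rfl⟩ := Submodule.mem_span_singleton.mp hu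
    have h1 : ⟪Q k, w⟫ = 0 := by rw [hQ, real_inner_comm, horth k hk]
    have h2 : ⟪Q (k + t • w), k + t • w⟫ = ⟪Q k, k⟫ + t ^ 2 * ⟪Q w, w⟫ := by
      simp only [map_add, map_smul, inner_add_left, inner_add_right, real_inner_smul_left,
        real_inner_smul_right, h1, horth k hk]
      ring
    rw [h2]
    by_cases hk0 : k = 0
    · subst hk0
      have ht : t ≠ 0 := by
        rintro rfl
        simp at hx0
      have : 0 < t ^ 2 * ⟪Q w, w⟫ := by positivity
      simpa using this
    · have := hker k hk hk0
      positivity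
  have hlt : K < K ⊔ Submodule.span ℝ {w} :=
    lt_of_le_of_ne le_sup_left fun h => hwK (h ▸ Submodule.mem_sup_right
      (Submodule.mem_span_singleton_self w))
  have h1 := Submodule.finrank_lt_finrank_of_lt hlt
  have h2 := finrank_le_posIndex hW
  omega

end LinearAlgebra

section Monotonicity

variable {k m : ℕ} {E : Fin k → Type*} {F : Fin m → Type*}
  [∀ i, NormedAddCommGroup (E i)] [∀ i, InnerProductSpace ℝ (E i)]
  [∀ i, FiniteDimensional ℝ (E i)]
  [∀ j, NormedAddCommGroup (F j)] [∀ j, InnerProductSpace ℝ (F j)]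
  [∀ j, FiniteDimensional ℝ (F j)]
  {c : Fin k → ℝ} {d : Fin m → ℝ}
  {H : Type*} [NormedAddCommGroup H] [InnerProductSpace ℝ H] [FiniteDimensional ℝ H]
  {U : ∀ i, H →ₗ[ℝ] E i} {V : ∀ j, H →ₗ[ℝ] F j}

theorem inner_sum_adjoint_comp (x : H) :
    ⟪(∑ j, d j • (LinearMap.adjoint (V j) ∘ₗ (V j))) x, x⟫ = ∑ j, d j * ‖V j x‖ ^ 2 := by
  simp [LinearMap.sum_apply, sum_inner, real_inner_smul_left, LinearMap.adjoint_inner_left]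

theorem exists_lift {Q : H →ₗ[ℝ] H} (hQ : Q.IsSymmetric)
    (hsum : Q + (∑ i, c i • (LinearMap.adjoint (U i) ∘ₗ (U i))) =
      ∑ j, d j • (LinearMap.adjoint (V j) ∘ₗ (V j)))
    (hpos : PosDef (∑ j, d j • (LinearMap.adjoint (V j) ∘ₗ (V j))))
    (hdim : posIndex Q + (∑ i, Module.finrank ℝ (E i)) ≤ Module.finrank ℝ H)
    (b : ∀ i, E i) :
    ∃ w, (∀ i, U i w = b i) ∧ ∑ j, d j * ‖V j w‖ ^ 2 ≤ ∑ i, c i * ‖b i‖ ^ 2 := by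
  have hq : ∀ x, ⟪Q x, x⟫ + ∑ i, c i * ‖U i x‖ ^ 2 = ∑ j, d j * ‖V j x‖ ^ 2 := fun x => by
    rw [← inner_sum_adjoint_comp, ← inner_sum_adjoint_comp, ← inner_add_left, ← hsum]
    rfl
  obtain ⟨w, hw, hw'⟩ := exists_apply_eq_and_inner_nonpos hQ (LinearMap.pi U) (fun x hx hx0 => by
    have h1 := hpos.2 x hx0
    rw [inner_sum_adjoint_comp, ← hq] at h1
    have h2 : ∀ i, U i x = 0 := fun i => congrFun (mem_ker.mp hx) i
    simpa [h2] using h1) (by rwa [Module.finrank_pi_fintype]) b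
  have hwi : ∀ i, U i w = b i := fun i => congrFun hw i
  refine ⟨w, hwi, ?_⟩
  rw [← hq]
  simp only [hwi]
  linarith

variable [∀ i, MeasurableSpace (E i)] [∀ i, BorelSpace (E i)]
  [∀ j, MeasurableSpace (F j)] [∀ j, BorelSpace (F j)]

/-- One time step of the heat flow almost preserves the pointwise inequality. -/
theorem exists_heat_step (hc : ∀ i, 0 < c i) (hd : ∀ j, 0 < d j)
    (hU : ∀ i, (U i) ∘ₗ LinearMap.adjoint (U i) = LinearMap.id)
    (hV : ∀ j, (V j) ∘ₗ LinearMap.adjoint (V j) = LinearMap.id)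
    (hlift : ∀ b : ∀ i, E i,
      ∃ w, (∀ i, U i w = b i) ∧ ∑ j, d j * ‖V j w‖ ^ 2 ≤ ∑ i, c i * ‖b i‖ ^ 2)
    (Λ : Fin k → ℝ) {a b : ℝ} (ha : 0 < a) :
    ∃ C, ∀ (φ : ∀ i, E i → ℝ) (ψ : ∀ j, F j → ℝ) (δ : ℝ),
      (∀ i, ∃ g, QuadExpansion (Λ i) (φ i) g) → (∀ i y, φ i y ∈ Set.Icc a b) →
      (∀ j, Measurable (ψ j)) → (∀ j y, ψ j y ∈ Set.Icc a b) →
      (∀ x, ∑ i, c i * Real.log (φ i (U i x)) ≤ ∑ j, d j * Real.log (ψ j (V j x)) + δ) →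
      ∀ h ∈ Set.Icc (0 : ℝ) 1, ∀ x, ∑ i, c i * Real.log (heat h (φ i) (U i x)) ≤
        ∑ j, d j * Real.log (heat h (ψ j) (V j x)) + (δ + C * h ^ 2) := by
  let _ : MeasurableSpace H := borel H
  have : BorelSpace H := ⟨rfl⟩
  choose C hC0 hC using fun i => exists_log_integral_exp_le (G := E i)
    ((a⁻¹ + a⁻¹ ^ 2) * (Λ i + Λ i ^ 2)) (Real.log a) (Real.log b)
  refine ⟨∑ i, c i * C i, fun φ ψ δ hφ hφab hψ hψab hle h hh x => ?_⟩
  choose g hg using hφ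
  set u : ∀ i, E i → ℝ := fun i y => Real.log (φ i y) with hu
  have hlogab : ∀ t ∈ Set.Icc a b, Real.log t ∈ Set.Icc (Real.log a) (Real.log b) := fun t ht =>
    ⟨Real.log_le_log ha ht.1, Real.log_le_log (ha.trans_le ht.1) ht.2⟩
  have huq : ∀ i, QuadExpansion _ (u i) _ := fun i => (hg i).log ha (hφab i)
  set β : ∀ i, E i := fun i => (φ i (U i x))⁻¹ • g i (U i x) with hβ
  obtain ⟨w, hw, hwle⟩ := hlift β
  have hφm : ∀ i, Measurable (u i) := fun i => (huq i).measurable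
  have hψm : ∀ j, Measurable fun y => Real.log (ψ j y) := fun j => Real.measurable_log.comp (hψ j)
  have hUm : ∀ i, Measurable (U i) := fun i => (U i).continuous_of_finiteDimensional.measurable
  have hVm : ∀ j, Measurable (V j) := fun j => (V j).continuous_of_finiteDimensional.measurable
  have h1 : ∀ i, Real.log (heat h (φ i) (U i x)) ≤
      ∫ z, u i (U i (x + √h • z + h • w)) ∂(stdGaussian H) - h * ‖β i‖ ^ 2 / 2 + C i * h ^ 2 := by
    intro i
    have e := hC i (u i) _ (huq i) (fun y => hlogab _ (hφab i y)) h hh (U i x)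
    have e1 : heat h (φ i) (U i x) =
        ∫ z, Real.exp (u i (U i x + √h • z)) ∂(stdGaussian (E i)) := by
      refine integral_congr_ae (Filter.Eventually.of_forall fun z => ?_)
      exact (Real.exp_log (ha.trans_le (hφab i _).1)).symm
    rw [e1]
    refine e.trans (le_of_eq ?_)
    rw [← integral_comp_of_comp_adjoint (U i) (hU i)
      (φ := fun z => u i (U i x + √h • z + h • β i)) ((hφm i).comp (by fun_prop))]
    simp only [map_add, map_smul, hw, hβ]
  have h2 : ∀ j, ∫ z, Real.log (ψ j (V j (x + √h • z + h • w))) ∂(stdGaussian H) -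
      h * ‖V j w‖ ^ 2 / 2 ≤ Real.log (heat h (ψ j) (V j x)) := by
    intro j
    refine le_trans (le_of_eq ?_)
      (integral_log_sub_le_log_heat ha (hψ j) (hψab j) hh.1 (V j x) (V j w))
    rw [← integral_comp_of_comp_adjoint (V j) (hV j)
      (φ := fun z => Real.log (ψ j (V j x + √h • z + h • V j w))) ((hψm j).comp (by fun_prop))]
    simp only [map_add, map_smul]
  have hi1 : ∀ i, Integrable (fun z => c i * u i (U i (x + √h • z + h • w))) (stdGaussian H) :=
    fun i => (integrable_of_forall_mem_Icc (φ := fun z => u i (U i z)) ((hφm i).comp (hUm i))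
      (fun y => hlogab _ (hφab i _)) (τ := fun z => x + √h • z + h • w) (by fun_prop)).const_mul _
  have hi2 : ∀ j, Integrable (fun z => d j * Real.log (ψ j (V j (x + √h • z + h • w))))
      (stdGaussian H) :=
    fun j => (integrable_of_forall_mem_Icc (φ := fun z => Real.log (ψ j (V j z)))
      ((hψm j).comp (hVm j)) (fun y => hlogab _ (hψab j _)) (τ := fun z => x + √h • z + h • w)
      (by fun_prop)).const_mul _
  have h3 : ∑ i, c i * ∫ z, u i (U i (x + √h • z + h • w)) ∂(stdGaussian H) ≤
      ∑ j, d j * ∫ z, Real.log (ψ j (V j (x + √h • z + h • w))) ∂(stdGaussian H) + δ := by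
    have := integral_mono (integrable_finsetSum Finset.univ fun i _ => hi1 i)
      ((integrable_finsetSum Finset.univ fun j _ => hi2 j).add (integrable_const δ))
      fun z => hle (x + √h • z + h • w)
    have e2 : ∫ z, (∑ j, d j * Real.log (ψ j (V j (x + √h • z + h • w))) + δ) ∂(stdGaussian H) =
        ∑ j, d j * ∫ z, Real.log (ψ j (V j (x + √h • z + h • w))) ∂(stdGaussian H) + δ := by
      rw [integral_add (integrable_finsetSum Finset.univ fun j _ => hi2 j) (integrable_const δ),
        integral_finsetSum _ fun j _ => hi2 j]
      simp [integral_const_mul]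
    rw [integral_finsetSum _ fun i _ => hi1 i] at this
    simp only [integral_const_mul] at this
    exact this.trans e2.le
  have h4 := Finset.sum_le_sum fun i (_ : i ∈ Finset.univ) =>
    mul_le_mul_of_nonneg_left (h1 i) (hc i).le
  have h5 := Finset.sum_le_sum fun j (_ : j ∈ Finset.univ) =>
    mul_le_mul_of_nonneg_left (h2 j) (hd j).le
  have e3 : ∀ i, c i * (∫ z, u i (U i (x + √h • z + h • w)) ∂(stdGaussian H) - h * ‖β i‖ ^ 2 / 2 +
      C i * h ^ 2) = c i * ∫ z, u i (U i (x + √h • z + h • w)) ∂(stdGaussian H) -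
      h / 2 * (c i * ‖β i‖ ^ 2) + c i * C i * h ^ 2 := fun i => by ring
  have e4 : ∀ j, d j * (∫ z, Real.log (ψ j (V j (x + √h • z + h • w))) ∂(stdGaussian H) -
      h * ‖V j w‖ ^ 2 / 2) = d j * ∫ z, Real.log (ψ j (V j (x + √h • z + h • w))) ∂(stdGaussian H) -
      h / 2 * (d j * ‖V j w‖ ^ 2) := fun j => by ring
  simp only [e3, e4, Finset.sum_add_distrib, Finset.sum_sub_distrib, ← Finset.mul_sum,
    ← Finset.sum_mul] at h4 h5
  have h6 := mul_le_mul_of_nonneg_left hwle (by linarith [hh.1] : 0 ≤ h / 2)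
  linarith

/-- The heat flow preserves the pointwise inequality. -/
theorem heat_monotone (hc : ∀ i, 0 < c i) (hd : ∀ j, 0 < d j)
    (hU : ∀ i, (U i) ∘ₗ LinearMap.adjoint (U i) = LinearMap.id)
    (hV : ∀ j, (V j) ∘ₗ LinearMap.adjoint (V j) = LinearMap.id)
    (hlift : ∀ b : ∀ i, E i,
      ∃ w, (∀ i, U i w = b i) ∧ ∑ j, d j * ‖V j w‖ ^ 2 ≤ ∑ i, c i * ‖b i‖ ^ 2)
    {a b : ℝ} (ha : 0 < a) {φ : ∀ i, E i → ℝ} {ψ : ∀ j, F j → ℝ}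
    (hφ : ∀ i, ∃ Λ g, QuadExpansion Λ (φ i) g) (hφab : ∀ i y, φ i y ∈ Set.Icc a b)
    (hψ : ∀ j, Measurable (ψ j)) (hψab : ∀ j y, ψ j y ∈ Set.Icc a b)
    (hle : ∀ x, ∑ i, c i * Real.log (φ i (U i x)) ≤ ∑ j, d j * Real.log (ψ j (V j x)))
    {T : ℝ} (hT : T ∈ Set.Icc (0 : ℝ) 1) (x : H) :
    ∑ i, c i * Real.log (heat T (φ i) (U i x)) ≤
      ∑ j, d j * Real.log (heat T (ψ j) (V j x)) := by
  choose Λ hΛ using hφ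
  have hφm : ∀ i, Measurable (φ i) := fun i => (hΛ i).choose_spec.measurable
  obtain ⟨C, hC⟩ := exists_heat_step hc hd hU hV hlift Λ ha (b := b)
  have hn : ∀ n : ℕ, ∑ i, c i * Real.log (heat T (φ i) (U i x)) ≤
      ∑ j, d j * Real.log (heat T (ψ j) (V j x)) + C * T ^ 2 * (1 / ((n : ℝ) + 1)) := by
    intro n
    have hn0 : (0 : ℝ) < n + 1 := by positivity
    set h := T / (n + 1) with hh
    have hh0 : 0 ≤ h := div_nonneg hT.1 hn0.le
    have hh1 : h ≤ 1 := (div_le_self hT.1 (by linarith [n.cast_nonneg (α := ℝ)])).trans hT.2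
    have hl : ∀ (l : ℕ) x, ∑ i, c i * Real.log (heat (l * h) (φ i) (U i x)) ≤
        ∑ j, d j * Real.log (heat (l * h) (ψ j) (V j x)) + l * (C * h ^ 2) := by
      intro l
      induction l with
      | zero => simpa [heat] using hle
      | succ l ih =>
        intro x
        have hlh : 0 ≤ l * h := by positivity
        have := hC (fun i => heat (l * h) (φ i)) (fun j => heat (l * h) (ψ j)) _
          (fun i => ⟨_, (hΛ i).choose_spec.heat (hφab i) _⟩)
          (fun i => heat_mem_Icc (hφm i) (hφab i) _) (fun j => measurable_heat (hψ j) _)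
          (fun j => heat_mem_Icc (hψ j) (hψab j) _) ih h ⟨hh0, hh1⟩ x
        simp only [fun i => heat_heat (hφm i) (hφab i) hh0 hlh,
          fun j => heat_heat (hψ j) (hψab j) hh0 hlh] at this
        rw [show ((l + 1 : ℕ) : ℝ) * h = h + l * h by push_cast; ring]
        refine this.trans (le_of_eq ?_)
        push_cast
        ring
    have := hl (n + 1) x
    have e : ((n + 1 : ℕ) : ℝ) * h = T := by rw [hh]; push_cast; field_simp
    rw [e] at this
    refine this.trans (le_of_eq ?_)
    rw [hh]
    push_cast
    field_simp
  have hlim := (tendsto_one_div_add_atTop_nhds_zero_nat (𝕜 := ℝ)).const_mul (C * T ^ 2)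
    |>.const_add (∑ j, d j * Real.log (heat T (ψ j) (V j x)))
  rw [mul_zero, add_zero] at hlim
  exact ge_of_tendsto' hlim hn

end Monotonicity

section SmallTime

variable {G : Type*} [NormedAddCommGroup G] [InnerProductSpace ℝ G]
  [FiniteDimensional ℝ G] [MeasurableSpace G] [BorelSpace G]

theorem abs_exp_sub_exp_le {p q B : ℝ} (hp : p ≤ B) (hq : q ≤ B) :
    |Real.exp p - Real.exp q| ≤ Real.exp B * |p - q| := by
  wlog h : q ≤ p generalizing p q
  · rw [abs_sub_comm, abs_sub_comm p]
    exact this hq hp (le_of_not_ge h)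
  have h1 : Real.exp p - Real.exp q ≤ Real.exp p * (p - q) := by
    have h2 := Real.add_one_le_exp (q - p)
    have h3 : Real.exp q = Real.exp p * Real.exp (q - p) := by rw [← Real.exp_add]; congr 1; ring
    rw [h3]
    nlinarith [Real.exp_pos p]
  rw [abs_of_nonneg (sub_nonneg.mpr (Real.exp_le_exp.mpr h)), abs_of_nonneg (sub_nonneg.mpr h)]
  exact h1.trans (mul_le_mul_of_nonneg_right (Real.exp_le_exp.mpr hp) (sub_nonneg.mpr h))

theorem exp_mem_Icc {p A B : ℝ} (hp : p ∈ Set.Icc A B) :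
    Real.exp p ∈ Set.Icc (Real.exp A) (Real.exp B) :=
  ⟨Real.exp_le_exp.mpr hp.1, Real.exp_le_exp.mpr hp.2⟩

theorem abs_heat_exp_heat_sub_le {ℓ κ : G → ℝ} {A B : ℝ} (hℓ : Measurable ℓ)
    (hℓAB : ∀ y, ℓ y ∈ Set.Icc A B) (hκ : Measurable κ) (hκAB : ∀ y, κ y ∈ Set.Icc A B)
    {s : ℝ} (hs0 : 0 ≤ s) (hs1 : s ≤ 1) :
    |heat (1 - s) (fun y => Real.exp (heat s ℓ y)) 0 -
      heat (1 - s) (fun y => Real.exp (heat s κ y)) 0| ≤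
      Real.exp B * ∫ z, |ℓ z - κ z| ∂(stdGaussian G) := by
  have hr : Measurable fun y => |ℓ y - κ y| := (hℓ.sub hκ).abs
  have hrAB : ∀ y, |ℓ y - κ y| ∈ Set.Icc 0 (B - A) := fun y =>
    ⟨abs_nonneg _, abs_sub_le_iff.mpr
      ⟨by linarith [(hℓAB y).2, (hκAB y).1], by linarith [(hℓAB y).1, (hκAB y).2]⟩⟩
  have hpt : ∀ y, |Real.exp (heat s ℓ y) - Real.exp (heat s κ y)| ≤
      Real.exp B * heat s (fun y => |ℓ y - κ y|) y := by
    intro y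
    refine (abs_exp_sub_exp_le (heat_mem_Icc hℓ hℓAB s y).2 (heat_mem_Icc hκ hκAB s y).2).trans
      (mul_le_mul_of_nonneg_left ?_ (Real.exp_pos B).le)
    rw [heat, heat, ← integral_sub (integrable_of_forall_mem_Icc hℓ hℓAB (by fun_prop))
      (integrable_of_forall_mem_Icc hκ hκAB (by fun_prop))]
    exact abs_integral_le_integral_abs
  have hi : ∀ {ρ : G → ℝ}, Measurable ρ → (∀ y, ρ y ∈ Set.Icc A B) →
      Integrable (fun z => Real.exp (heat s ρ (0 + √(1 - s) • z))) (stdGaussian G) :=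
    fun hρ hρAB => integrable_of_forall_mem_Icc (Real.measurable_exp.comp (measurable_heat hρ s))
      (fun y => exp_mem_Icc (heat_mem_Icc hρ hρAB s y)) (by fun_prop)
  have e := heat_heat hr hrAB (sub_nonneg.mpr hs1) hs0 0
  rw [sub_add_cancel, heat_zero_one, heat] at e
  rw [heat, heat, ← integral_sub (hi hℓ hℓAB) (hi hκ hκAB), ← e, ← integral_const_mul,
    ← Real.norm_eq_abs]
  exact norm_integral_le_of_norm_le ((integrable_of_forall_mem_Icc (measurable_heat hr s)
    (heat_mem_Icc hr hrAB s) (by fun_prop)).const_mul _) (Filter.Eventually.of_forall fun z => hpt _)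

theorem tendsto_heat_exp_heat_of_continuous {κ : G → ℝ} {A B : ℝ} (hκ : Continuous κ)
    (hκAB : ∀ y, κ y ∈ Set.Icc A B) :
    Filter.Tendsto (fun s => heat (1 - s) (fun y => Real.exp (heat s κ y)) 0) (nhds 0)
      (nhds (∫ z, Real.exp (κ z) ∂(stdGaussian G))) := by
  have hm := hκ.measurable
  have h1 : ∀ z, Filter.Tendsto (fun s => heat s κ (0 + √(1 - s) • z)) (nhds 0) (nhds (κ z)) := by
    intro z
    have : Filter.Tendsto (fun s : ℝ => ∫ x, κ (0 + √(1 - s) • z + √s • x) ∂(stdGaussian G))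
        (nhds 0) (nhds (∫ _, κ z ∂(stdGaussian G))) := by
      refine tendsto_integral_filter_of_dominated_convergence (fun _ => max |A| |B|)
        (Filter.Eventually.of_forall fun s => (hm.comp (by fun_prop)).aestronglyMeasurable)
        (Filter.Eventually.of_forall fun s => Filter.Eventually.of_forall fun x =>
          abs_le_max_abs_abs (hκAB _).1 (hκAB _).2) (integrable_const _)
        (Filter.Eventually.of_forall fun x => ?_)
      have hcont : Continuous fun s : ℝ => κ (0 + √(1 - s) • z + √s • x) := by fun_prop
      simpa using hcont.tendsto 0
    simpa [heat] using this
  refine tendsto_integral_filter_of_dominated_convergence (fun _ => Real.exp B)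
    (Filter.Eventually.of_forall fun s => ((Real.measurable_exp.comp
      (measurable_heat hm s)).comp (by fun_prop)).aestronglyMeasurable)
    (Filter.Eventually.of_forall fun s => Filter.Eventually.of_forall fun x => ?_)
    (integrable_const _) (Filter.Eventually.of_forall fun z => ?_)
  · rw [Real.norm_eq_abs, Real.abs_exp]
    exact (exp_mem_Icc (heat_mem_Icc hm hκAB s _)).2
  · exact (Real.continuous_exp.tendsto _).comp (h1 z)

theorem tendsto_heat_exp_heat {ℓ : G → ℝ} {A B : ℝ} (hℓ : Measurable ℓ)
    (hℓAB : ∀ y, ℓ y ∈ Set.Icc A B) :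
    Filter.Tendsto (fun s => heat (1 - s) (fun y => Real.exp (heat s ℓ y)) 0)
      (nhdsWithin 0 (Set.Ioo 0 1)) (nhds (∫ z, Real.exp (ℓ z) ∂(stdGaussian G))) := by
  have hAB : A ≤ B := (hℓAB 0).1.trans (hℓAB 0).2
  have hℓi : Integrable ℓ (stdGaussian G) :=
    integrable_of_forall_mem_Icc hℓ hℓAB (τ := fun z => z) measurable_id
  rw [Metric.tendsto_nhds]
  intro ε hε
  obtain ⟨k, hk, hki⟩ := hℓi.exists_boundedContinuous_integral_sub_le
    (ε := ε / (4 * Real.exp B)) (by positivity)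
  set κ : G → ℝ := fun z => max A (min B (k z)) with hκ
  have hκc : Continuous κ := by fun_prop
  have hκAB : ∀ y, κ y ∈ Set.Icc A B := fun y => ⟨le_max_left _ _, max_le hAB (min_le_left _ _)⟩
  have hκi : Integrable κ (stdGaussian G) :=
    integrable_of_forall_mem_Icc hκc.measurable hκAB (τ := fun z => z) measurable_id
  have hd : Real.exp B * ∫ z, |ℓ z - κ z| ∂(stdGaussian G) ≤ ε / 4 := by
    have h1 : ∫ z, |ℓ z - κ z| ∂(stdGaussian G) ≤ ∫ z, ‖ℓ z - k z‖ ∂(stdGaussian G) := by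
      refine integral_mono (hℓi.sub hκi).abs (hℓi.sub hki).norm fun z => ?_
      have e : ℓ z = max A (min B (ℓ z)) := by
        rw [min_eq_right (hℓAB z).2, max_eq_right (hℓAB z).1]
      calc |ℓ z - κ z| = |max A (min B (ℓ z)) - max A (min B (k z))| := by rw [← e]
        _ ≤ |min B (ℓ z) - min B (k z)| := by
          simpa using abs_max_sub_max_le_max A (min B (ℓ z)) A (min B (k z))
        _ ≤ ‖ℓ z - k z‖ := by
          simpa using abs_min_sub_min_le_max B (ℓ z) B (k z)
    calc _ ≤ Real.exp B * (ε / (4 * Real.exp B)) := by gcongr; exact h1.trans hk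
      _ = _ := by field_simp
  have hd' : |∫ z, Real.exp (κ z) ∂(stdGaussian G) - ∫ z, Real.exp (ℓ z) ∂(stdGaussian G)| ≤
      ε / 4 := by
    have hi : ∀ {ρ : G → ℝ}, Measurable ρ → (∀ y, ρ y ∈ Set.Icc A B) →
        Integrable (fun z => Real.exp (ρ z)) (stdGaussian G) := fun hρ hρAB =>
      integrable_of_forall_mem_Icc (Real.measurable_exp.comp hρ) (fun y => exp_mem_Icc (hρAB y))
        (τ := fun z => z) measurable_id
    refine le_trans ?_ hd
    rw [abs_sub_comm, ← integral_sub (hi hℓ hℓAB) (hi hκc.measurable hκAB), ← integral_const_mul,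
      ← Real.norm_eq_abs]
    exact norm_integral_le_of_norm_le ((hℓi.sub hκi).abs.const_mul _)
      (Filter.Eventually.of_forall fun z => abs_exp_sub_exp_le (hℓAB z).2 (hκAB z).2)
  have hlim := Metric.tendsto_nhds.mp ((tendsto_heat_exp_heat_of_continuous hκc hκAB).mono_left
    (nhdsWithin_le_nhds (s := Set.Ioo (0 : ℝ) 1))) (ε / 4) (by positivity)
  filter_upwards [hlim, self_mem_nhdsWithin] with s hs hs01
  have h1 := (abs_heat_exp_heat_sub_le hℓ hℓAB hκc.measurable hκAB hs01.1.le hs01.2.le).trans hd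
  rw [Real.dist_eq] at hs ⊢
  rw [abs_lt] at hs ⊢
  rw [abs_le] at h1 hd'
  constructor <;> linarith

end SmallTime

section Bounded

variable {k m : ℕ} {E : Fin k → Type*} {F : Fin m → Type*}
  [∀ i, NormedAddCommGroup (E i)] [∀ i, InnerProductSpace ℝ (E i)]
  [∀ i, FiniteDimensional ℝ (E i)]
  [∀ i, MeasurableSpace (E i)] [∀ i, BorelSpace (E i)]
  [∀ j, NormedAddCommGroup (F j)] [∀ j, InnerProductSpace ℝ (F j)]
  [∀ j, FiniteDimensional ℝ (F j)]
  [∀ j, MeasurableSpace (F j)] [∀ j, BorelSpace (F j)]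
  {c : Fin k → ℝ} {d : Fin m → ℝ}
  {H : Type*} [NormedAddCommGroup H] [InnerProductSpace ℝ H] [FiniteDimensional ℝ H]
  {U : ∀ i, H →ₗ[ℝ] E i} {V : ∀ j, H →ₗ[ℝ] F j}

/-- The pointwise inequality is preserved by geometric averaging of the `f i` and arithmetic
averaging of the `g j`. -/
theorem sum_heat_log_le (hd : ∀ j, 0 < d j)
    (hU : ∀ i, (U i) ∘ₗ LinearMap.adjoint (U i) = LinearMap.id)
    (hV : ∀ j, (V j) ∘ₗ LinearMap.adjoint (V j) = LinearMap.id)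
    {a b : ℝ} (ha : 0 < a) {f : ∀ i, E i → ℝ} {g : ∀ j, F j → ℝ}
    (hf : ∀ i, Measurable (f i)) (hfab : ∀ i y, f i y ∈ Set.Icc a b)
    (hg : ∀ j, Measurable (g j)) (hgab : ∀ j y, g j y ∈ Set.Icc a b)
    (hle : ∀ x, ∑ i, c i * Real.log (f i (U i x)) ≤ ∑ j, d j * Real.log (g j (V j x)))
    {s : ℝ} (hs : 0 ≤ s) (x : H) :
    ∑ i, c i * heat s (fun y => Real.log (f i y)) (U i x) ≤
      ∑ j, d j * Real.log (heat s (g j) (V j x)) := by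
  let _ : MeasurableSpace H := borel H
  have : BorelSpace H := ⟨rfl⟩
  have hlogab : ∀ t ∈ Set.Icc a b, Real.log t ∈ Set.Icc (Real.log a) (Real.log b) := fun t ht =>
    ⟨Real.log_le_log ha ht.1, Real.log_le_log (ha.trans_le ht.1) ht.2⟩
  have hUm : ∀ i, Measurable (U i) := fun i => (U i).continuous_of_finiteDimensional.measurable
  have hVm : ∀ j, Measurable (V j) := fun j => (V j).continuous_of_finiteDimensional.measurable
  have hfm : ∀ i, Measurable fun y => Real.log (f i y) := fun i => Real.measurable_log.comp (hf i)
  have hgm : ∀ j, Measurable fun y => Real.log (g j y) := fun j => Real.measurable_log.comp (hg j)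
  have h1 : ∀ i, heat s (fun y => Real.log (f i y)) (U i x) =
      ∫ z, Real.log (f i (U i (x + √s • z))) ∂(stdGaussian H) := fun i => by
    rw [heat, ← integral_comp_of_comp_adjoint (U i) (hU i)
      (φ := fun z => Real.log (f i (U i x + √s • z))) ((hfm i).comp (by fun_prop))]
    simp only [map_add, map_smul]
  have h2 : ∀ j, ∫ z, Real.log (g j (V j (x + √s • z))) ∂(stdGaussian H) ≤
      Real.log (heat s (g j) (V j x)) := fun j => by
    have := integral_log_sub_le_log_heat ha (hg j) (hgab j) hs (V j x) 0
    simp only [smul_zero, add_zero, norm_zero] at this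
    rw [← integral_comp_of_comp_adjoint (V j) (hV j)
      (φ := fun z => Real.log (g j (V j x + √s • z))) ((hgm j).comp (by fun_prop))] at this
    simpa using this
  have hi1 : ∀ i, Integrable (fun z => c i * Real.log (f i (U i (x + √s • z)))) (stdGaussian H) :=
    fun i => (integrable_of_forall_mem_Icc (φ := fun z => Real.log (f i (U i z)))
      ((hfm i).comp (hUm i)) (fun y => hlogab _ (hfab i _)) (τ := fun z => x + √s • z)
      (by fun_prop)).const_mul _
  have hi2 : ∀ j, Integrable (fun z => d j * Real.log (g j (V j (x + √s • z)))) (stdGaussian H) :=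
    fun j => (integrable_of_forall_mem_Icc (φ := fun z => Real.log (g j (V j z)))
      ((hgm j).comp (hVm j)) (fun y => hlogab _ (hgab j _)) (τ := fun z => x + √s • z)
      (by fun_prop)).const_mul _
  have h3 := integral_mono (integrable_finsetSum Finset.univ fun i _ => hi1 i)
    (integrable_finsetSum Finset.univ fun j _ => hi2 j) fun z => hle (x + √s • z)
  rw [integral_finsetSum _ fun i _ => hi1 i, integral_finsetSum _ fun j _ => hi2 j] at h3
  simp only [integral_const_mul] at h3
  simp only [h1]
  exact h3.trans (Finset.sum_le_sum fun j _ => mul_le_mul_of_nonneg_left (h2 j) (hd j).le)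

/-- The inequality for functions bounded away from zero and infinity, in logarithmic form. -/
theorem sum_log_integral_le (hc : ∀ i, 0 < c i) (hd : ∀ j, 0 < d j)
    (hU : ∀ i, (U i) ∘ₗ LinearMap.adjoint (U i) = LinearMap.id)
    (hV : ∀ j, (V j) ∘ₗ LinearMap.adjoint (V j) = LinearMap.id)
    (hlift : ∀ b : ∀ i, E i,
      ∃ w, (∀ i, U i w = b i) ∧ ∑ j, d j * ‖V j w‖ ^ 2 ≤ ∑ i, c i * ‖b i‖ ^ 2)
    {a b : ℝ} (ha : 0 < a) {f : ∀ i, E i → ℝ} {g : ∀ j, F j → ℝ}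
    (hf : ∀ i, Measurable (f i)) (hfab : ∀ i y, f i y ∈ Set.Icc a b)
    (hg : ∀ j, Measurable (g j)) (hgab : ∀ j y, g j y ∈ Set.Icc a b)
    (hle : ∀ x, ∑ i, c i * Real.log (f i (U i x)) ≤ ∑ j, d j * Real.log (g j (V j x))) :
    ∑ i, c i * Real.log (∫ y, f i y ∂(stdGaussian (E i))) ≤
      ∑ j, d j * Real.log (∫ y, g j y ∂(stdGaussian (F j))) := by
  have hfpos : ∀ i y, 0 < f i y := fun i y => ha.trans_le (hfab i y).1
  set ℓ : ∀ i, E i → ℝ := fun i y => Real.log (f i y) with hℓ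
  have hℓm : ∀ i, Measurable (ℓ i) := fun i => Real.measurable_log.comp (hf i)
  have hℓab : ∀ i y, ℓ i y ∈ Set.Icc (Real.log a) (Real.log b) := fun i y =>
    ⟨Real.log_le_log ha (hfab i y).1, Real.log_le_log (hfpos i y) (hfab i y).2⟩
  have hs : ∀ s ∈ Set.Ioo (0 : ℝ) 1,
      ∑ i, c i * Real.log (heat (1 - s) (fun y => Real.exp (heat s (ℓ i) y)) 0) ≤
        ∑ j, d j * Real.log (∫ y, g j y ∂(stdGaussian (F j))) := by
    intro s hs
    have := heat_monotone hc hd hU hV hlift ha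
      (φ := fun i y => Real.exp (heat s (ℓ i) y)) (ψ := fun j => heat s (g j))
      (fun i => by
        obtain ⟨Λ, γ, h⟩ := exists_quadExpansion_heat (hℓm i) (hℓab i) hs.1
        exact ⟨_, _, h.exp (heat_mem_Icc (hℓm i) (hℓab i) s)⟩)
      (fun i y => by
        have h := exp_mem_Icc (heat_mem_Icc (hℓm i) (hℓab i) s y)
        rwa [Real.exp_log ha, Real.exp_log ((hfpos i 0).trans_le (hfab i 0).2)] at h)
      (fun j => measurable_heat (hg j) s) (fun j => heat_mem_Icc (hg j) (hgab j) s)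
      (fun x => by
        simpa only [Real.log_exp] using sum_heat_log_le hd hU hV ha hf hfab hg hgab hle hs.1.le x)
      (T := 1 - s) ⟨by linarith [hs.2], by linarith [hs.1]⟩ 0
    simpa only [map_zero, fun j => heat_heat (hg j) (hgab j) (sub_nonneg.mpr hs.2.le) hs.1.le,
      sub_add_cancel, heat_zero_one] using this
  have hlim : ∀ i, Filter.Tendsto
      (fun s => heat (1 - s) (fun y => Real.exp (heat s (ℓ i) y)) 0)
      (nhdsWithin 0 (Set.Ioo 0 1)) (nhds (∫ y, f i y ∂(stdGaussian (E i)))) := fun i => by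
    have := tendsto_heat_exp_heat (hℓm i) (hℓab i)
    simpa only [hℓ, Real.exp_log (hfpos i _)] using this
  have hpos : ∀ i, 0 < ∫ y, f i y ∂(stdGaussian (E i)) := fun i => by
    have := (heat_mem_Icc (hf i) (hfab i) 1 0).1
    rw [heat_zero_one] at this
    exact ha.trans_le this
  have : (nhdsWithin (0 : ℝ) (Set.Ioo 0 1)).NeBot := by
    rw [nhdsWithin_Ioo_eq_nhdsGT one_pos]
    infer_instance
  refine le_of_tendsto (tendsto_finsetSum _ fun i _ => ((Real.continuousAt_log
    (hpos i).ne').tendsto.comp (hlim i)).const_mul (c i)) ?_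
  filter_upwards [self_mem_nhdsWithin] with s hs01
  exact hs s hs01

end Bounded

section Truncation

variable {k m : ℕ} {E : Fin k → Type*} {F : Fin m → Type*}
  [∀ i, MeasurableSpace (E i)] [∀ j, MeasurableSpace (F j)]
  {c : Fin k → ℝ} {d : Fin m → ℝ} {H : Type*}
  {u : ∀ i, H → E i} {v : ∀ j, H → F j}
  {μ : ∀ i, Measure (E i)} {ν : ∀ j, Measure (F j)}

theorem prod_rpow_eq_exp_sum_log {ι : Type*} (s : Finset ι) (p x : ι → ℝ)
    (hx : ∀ i ∈ s, 0 < x i) : ∏ i ∈ s, x i ^ p i = Real.exp (∑ i ∈ s, p i * Real.log (x i)) := by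
  rw [Real.exp_sum]
  exact Finset.prod_congr rfl fun i hi => by rw [Real.rpow_def_of_pos (hx i hi), mul_comm]

/-- Truncation from above and below preserves a pointwise inequality of weighted products. -/
theorem prod_truncate_rpow_le (hc : ∀ i, 0 < c i) (hd : ∀ j, 0 < d j)
    {M N ω ε : ℝ≥0} (hM : 1 ≤ M) (hω : ω ≤ 1) (hN : 1 ≤ N) (hε1 : ε ≤ 1)
    (hε : ∀ i, ε ^ c i * ∏ i, M ^ c i ≤ ∏ j, ω ^ d j)
    (hNM : ∀ j, ∏ i, M ^ c i ≤ N ^ d j * ∏ j, ω ^ d j)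
    {p : Fin k → ℝ≥0} {q : Fin m → ℝ≥0} (hpq : ∏ i, p i ^ c i ≤ ∏ j, q j ^ d j) :
    ∏ i, max (min (p i) M) ε ^ c i ≤ ∏ j, min (max (q j) ω) N ^ d j := by
  have hωle : ∀ j, ω ≤ min (max (q j) ω) N := fun j =>
    le_min (le_max_right _ _) (hω.trans hN)
  have hleM : ∀ i, max (min (p i) M) ε ≤ M := fun i =>
    max_le (min_le_right _ _) (hε1.trans hM)
  by_cases h1 : ∃ i, p i < ε
  · obtain ⟨i, hi⟩ := h1
    calc ∏ i, max (min (p i) M) ε ^ c i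
        ≤ ∏ i', (if i' = i then ε ^ c i else 1) * M ^ c i' := by
          refine Finset.prod_le_prod' fun i' _ => ?_
          split_ifs with h
          · subst h
            have : max (min (p i') M) ε = ε := max_eq_right ((min_le_left _ _).trans hi.le)
            rw [this]
            exact le_mul_of_one_le_right' (NNReal.one_le_rpow hM (hc i').le)
          · rw [one_mul]
            exact NNReal.rpow_le_rpow (hleM i') (hc i').le
      _ = ε ^ c i * ∏ i, M ^ c i := by rw [Finset.prod_mul_distrib]; simp
      _ ≤ ∏ j, ω ^ d j := hε i
      _ ≤ _ := Finset.prod_le_prod' fun j _ => NNReal.rpow_le_rpow (hωle j) (hd j).le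
  by_cases h2 : ∃ j, N < q j
  · obtain ⟨j, hj⟩ := h2
    calc ∏ i, max (min (p i) M) ε ^ c i
        ≤ ∏ i, M ^ c i :=
          Finset.prod_le_prod' fun i _ => NNReal.rpow_le_rpow (hleM i) (hc i).le
      _ ≤ N ^ d j * ∏ j, ω ^ d j := hNM j
      _ = ∏ j', (if j' = j then N ^ d j else 1) * ω ^ d j' := by
          rw [Finset.prod_mul_distrib]; simp
      _ ≤ _ := by
          refine Finset.prod_le_prod' fun j' _ => ?_
          split_ifs with h
          · subst h
            have : min (max (q j') ω) N = N := min_eq_right (hj.le.trans (le_max_left _ _))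
            rw [this]
            exact mul_le_of_le_one_right' (NNReal.rpow_le_one hω (hd j').le)
          · rw [one_mul]
            exact NNReal.rpow_le_rpow (hωle j') (hd j').le
  push Not at h1 h2
  refine le_trans (Finset.prod_le_prod' fun i _ => NNReal.rpow_le_rpow ?_ (hc i).le)
    (hpq.trans (Finset.prod_le_prod' fun j _ => NNReal.rpow_le_rpow ?_ (hd j).le))
  · exact max_le (min_le_left _ _) (h1 i)
  · exact le_min (le_max_left _ _) (h2 j)

theorem exists_truncation_levels (hc : ∀ i, 0 < c i) (hd : ∀ j, 0 < d j)
    (A : ℝ≥0) {B : ℝ≥0} (hB : 0 < B) :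
    ∃ ε N : ℝ≥0, 0 < ε ∧ ε ≤ 1 ∧ 1 ≤ N ∧ (∀ i, ε ^ c i * A ≤ B) ∧ ∀ j, A ≤ N ^ d j * B := by
  have h1 : ∀ᶠ ε : ℝ≥0 in nhdsWithin 0 (Set.Ioi 0), ∀ i, ε ^ c i * A ≤ B := by
    rw [Filter.eventually_all]
    intro i
    have : Filter.Tendsto (fun ε : ℝ≥0 => ε ^ c i * A) (nhds 0) (nhds (0 ^ c i * A)) :=
      (((NNReal.continuous_rpow_const (hc i).le).mul_const A).tendsto 0)
    rw [NNReal.zero_rpow (hc i).ne', zero_mul] at this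
    exact ((this.mono_left nhdsWithin_le_nhds).eventually (gt_mem_nhds hB)).mono
      fun _ h => le_of_lt h
  have h2 : ∀ᶠ N : ℝ≥0 in Filter.atTop, ∀ j, A ≤ N ^ d j * B := by
    rw [Filter.eventually_all]
    intro j
    filter_upwards [(NNReal.tendsto_rpow_atTop (hd j)).eventually_ge_atTop (A / B)] with N hN
    exact (div_le_iff₀ hB).1 hN
  have h3 : ∀ᶠ ε : ℝ≥0 in nhdsWithin 0 (Set.Ioi 0), ε ≤ 1 :=
    nhdsWithin_le_nhds (Iic_mem_nhds zero_lt_one)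
  obtain ⟨ε, hε, hε1, hε0⟩ := (h1.and (h3.and self_mem_nhdsWithin)).exists
  obtain ⟨N, hN, hN1⟩ := (h2.and (Filter.eventually_ge_atTop 1)).exists
  exact ⟨ε, N, hε0, hε1, hN1, hε, hN⟩

variable (c d u v μ ν) in
/-- The integrated inequality holds for all measurable functions bounded above and away from
zero. -/
def HoldsForBounded : Prop :=
  ∀ (f : ∀ i, E i → ℝ≥0) (g : ∀ j, F j → ℝ≥0) (a b : ℝ≥0), 0 < a →
    (∀ i, Measurable (f i)) → (∀ j, Measurable (g j)) →
    (∀ i y, f i y ∈ Set.Icc a b) → (∀ j y, g j y ∈ Set.Icc a b) →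
    (∀ x, ∏ i, f i (u i x) ^ c i ≤ ∏ j, g j (v j x) ^ d j) →
    ∏ i, (∫⁻ x, (f i x : ℝ≥0∞) ∂(μ i)) ^ c i ≤ ∏ j, (∫⁻ y, (g j y : ℝ≥0∞) ∂(ν j)) ^ d j

variable [∀ j, IsProbabilityMeasure (ν j)]

theorem HoldsForBounded.prod_lintegral_min_le (h : HoldsForBounded c d u v μ ν)
    (hc : ∀ i, 0 < c i) (hd : ∀ j, 0 < d j)
    {f : ∀ i, E i → ℝ≥0} {g : ∀ j, F j → ℝ≥0}
    (hf : ∀ i, Measurable (f i)) (hg : ∀ j, Measurable (g j))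
    (hfg : ∀ x, ∏ i, f i (u i x) ^ c i ≤ ∏ j, g j (v j x) ^ d j)
    {M ω : ℝ≥0} (hM : 1 ≤ M) (hω0 : 0 < ω) (hω : ω ≤ 1) :
    ∏ i, (∫⁻ x, (min (f i x) M : ℝ≥0) ∂(μ i)) ^ c i ≤
      ∏ j, ((∫⁻ y, (g j y : ℝ≥0∞) ∂(ν j)) + ω) ^ d j := by
  obtain ⟨ε, N, hε0, hε1, hN1, hε, hN⟩ := exists_truncation_levels hc hd (∏ i, M ^ c i)
    (B := ∏ j, ω ^ d j) (Finset.prod_pos fun j _ => NNReal.rpow_pos hω0)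
  have key := h (fun i y => max (min (f i y) M) ε) (fun j y => min (max (g j y) ω) N)
    (min ε ω) (max M N) (lt_min hε0 hω0)
    (fun i => ((hf i).min measurable_const).max measurable_const)
    (fun j => ((hg j).max measurable_const).min measurable_const)
    (fun i y => ⟨(min_le_left _ _).trans (le_max_right _ _),
      max_le ((min_le_right _ _).trans (le_max_left _ _))
        (hε1.trans (hM.trans (le_max_left _ _)))⟩)
    (fun j y => ⟨le_min ((min_le_right _ _).trans (le_max_right _ _))
      ((min_le_right _ _).trans (hω.trans hN1)), (min_le_right _ _).trans (le_max_right _ _)⟩)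
    (fun x => prod_truncate_rpow_le hc hd hM hω hN1 hε1 hε hN (hfg x))
  refine le_trans (Finset.prod_le_prod' fun i _ => ENNReal.rpow_le_rpow (lintegral_mono fun y =>
    ENNReal.coe_le_coe.2 (le_max_left _ _)) (hc i).le) (key.trans (Finset.prod_le_prod' fun j _ =>
      ENNReal.rpow_le_rpow ?_ (hd j).le))
  calc ∫⁻ y, (min (max (g j y) ω) N : ℝ≥0) ∂(ν j)
      ≤ ∫⁻ y, ((g j y : ℝ≥0∞) + ω) ∂(ν j) := lintegral_mono fun y => by
        rw [← ENNReal.coe_add, ENNReal.coe_le_coe]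
        exact (min_le_left _ _).trans (max_le le_self_add le_add_self)
    _ = _ := by rw [lintegral_add_right _ measurable_const]; simp

theorem tendsto_prod_of_ne_zero {ι α : Type*} {l : Filter α} (s : Finset ι)
    {φ : ι → α → ℝ≥0∞} {a : ι → ℝ≥0∞} (h : ∀ i ∈ s, Filter.Tendsto (φ i) l (nhds (a i)))
    (h0 : ∀ i ∈ s, a i ≠ 0) :
    Filter.Tendsto (fun t => ∏ i ∈ s, φ i t) l (nhds (∏ i ∈ s, a i)) := by
  classical
  induction s using Finset.induction with
  | empty => simp [tendsto_const_nhds]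
  | insert i s hi ih =>
    simp only [Finset.prod_insert hi]
    refine ENNReal.Tendsto.mul (h _ (Finset.mem_insert_self _ _))
      (Or.inl (h0 _ (Finset.mem_insert_self _ _)))
      (ih (fun j hj => h _ (Finset.mem_insert_of_mem hj)) fun j hj =>
        h0 _ (Finset.mem_insert_of_mem hj)) (Or.inl ?_)
    exact Finset.prod_ne_zero_iff.2 fun j hj => h0 _ (Finset.mem_insert_of_mem hj)

theorem tendsto_lintegral_min {α : Type*} [MeasurableSpace α] (ρ : Measure α) {φ : α → ℝ≥0}
    (hφ : Measurable φ) :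
    Filter.Tendsto (fun n : ℕ => ∫⁻ x, (min (φ x) (n + 1 : ℝ≥0) : ℝ≥0) ∂ρ) Filter.atTop
      (nhds (∫⁻ x, (φ x : ℝ≥0∞) ∂ρ)) := by
  refine lintegral_tendsto_of_tendsto_of_monotone
    (fun n => (hφ.min measurable_const).coe_nnreal_ennreal.aemeasurable)
    (Filter.Eventually.of_forall fun x n n' hn => ?_) (Filter.Eventually.of_forall fun x => ?_)
  · rw [ENNReal.coe_le_coe]
    gcongr
  · refine tendsto_const_nhds.congr' ?_
    obtain ⟨n₀, hn₀⟩ := exists_nat_ge (φ x)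
    filter_upwards [Filter.eventually_ge_atTop n₀] with n hn
    rw [min_eq_left]
    exact hn₀.trans ((Nat.cast_le.2 hn).trans le_self_add)

theorem HoldsForBounded.prod_lintegral_le_of_ne_top (h : HoldsForBounded c d u v μ ν)
    (hc : ∀ i, 0 < c i) (hd : ∀ j, 0 < d j)
    {f : ∀ i, E i → ℝ≥0} {g : ∀ j, F j → ℝ≥0}
    (hf : ∀ i, Measurable (f i)) (hg : ∀ j, Measurable (g j))
    (hfg : ∀ x, ∏ i, f i (u i x) ^ c i ≤ ∏ j, g j (v j x) ^ d j)
    (hgt : ∀ j, ∫⁻ y, (g j y : ℝ≥0∞) ∂(ν j) ≠ ⊤) :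
    ∏ i, (∫⁻ x, (f i x : ℝ≥0∞) ∂(μ i)) ^ c i ≤ ∏ j, (∫⁻ y, (g j y : ℝ≥0∞) ∂(ν j)) ^ d j := by
  have h1 : ∀ M : ℝ≥0, 1 ≤ M → ∏ i, (∫⁻ x, (min (f i x) M : ℝ≥0) ∂(μ i)) ^ c i ≤
      ∏ j, (∫⁻ y, (g j y : ℝ≥0∞) ∂(ν j)) ^ d j := fun M hM => by
    have ht : Filter.Tendsto (fun ω : ℝ≥0 => ∏ j, ((∫⁻ y, (g j y : ℝ≥0∞) ∂(ν j)) + ω) ^ d j)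
        (nhdsWithin 0 (Set.Ioi 0)) (nhds (∏ j, (∫⁻ y, (g j y : ℝ≥0∞) ∂(ν j)) ^ d j)) := by
      refine ENNReal.tendsto_finsetProd_of_ne_top _ (fun j _ => ?_)
        fun j _ => ENNReal.rpow_ne_top_of_nonneg (hd j).le (hgt j)
      have : Continuous fun ω : ℝ≥0 => ((∫⁻ y, (g j y : ℝ≥0∞) ∂(ν j)) + ω) ^ d j :=
        ENNReal.continuous_rpow_const.comp (continuous_const.add ENNReal.continuous_coe)
      have := (this.tendsto 0).mono_left (nhdsWithin_le_nhds (s := Set.Ioi 0))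
      simpa using this
    refine ge_of_tendsto ht ?_
    filter_upwards [self_mem_nhdsWithin,
      nhdsWithin_le_nhds (Iic_mem_nhds (zero_lt_one (α := ℝ≥0)))] with ω hω0 hω1
    exact h.prod_lintegral_min_le hc hd hf hg hfg hM hω0 hω1
  by_cases h0 : ∃ i, ∫⁻ x, (f i x : ℝ≥0∞) ∂(μ i) = 0
  · obtain ⟨i, hi⟩ := h0
    rw [Finset.prod_eq_zero (Finset.mem_univ i) (by rw [hi, ENNReal.zero_rpow_of_pos (hc i)])]
    exact zero_le
  push Not at h0
  refine le_of_tendsto' (tendsto_prod_of_ne_zero Finset.univ (fun i _ =>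
    (ENNReal.continuous_rpow_const.tendsto _).comp (tendsto_lintegral_min (μ i) (hf i)))
    fun i _ h => ?_) fun n => h1 (n + 1) le_add_self
  rcases ENNReal.rpow_eq_zero_iff.1 h with h | h
  · exact h0 i h.1
  · exact absurd h.2 (hc i).le.not_gt

theorem HoldsForBounded.prod_lintegral_le (h : HoldsForBounded c d u v μ ν)
    (hc : ∀ i, 0 < c i) (hd : ∀ j, 0 < d j)
    {f : ∀ i, E i → ℝ≥0} {g : ∀ j, F j → ℝ≥0}
    (hf : ∀ i, Measurable (f i)) (hg : ∀ j, Measurable (g j))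
    (hfg : ∀ x, ∏ i, f i (u i x) ^ c i ≤ ∏ j, g j (v j x) ^ d j) :
    ∏ i, (∫⁻ x, (f i x : ℝ≥0∞) ∂(μ i)) ^ c i ≤ ∏ j, (∫⁻ y, (g j y : ℝ≥0∞) ∂(ν j)) ^ d j := by
  by_cases ht : ∀ j, ∫⁻ y, (g j y : ℝ≥0∞) ∂(ν j) ≠ ⊤
  · exact h.prod_lintegral_le_of_ne_top hc hd hf hg hfg ht
  push Not at ht
  obtain ⟨j₁, hj₁⟩ := ht
  by_cases h0 : ∃ j, ∫⁻ y, (g j y : ℝ≥0∞) ∂(ν j) = 0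
  swap
  · push Not at h0
    have : ∏ j, (∫⁻ y, (g j y : ℝ≥0∞) ∂(ν j)) ^ d j = ⊤ := by
      rw [← Finset.mul_prod_erase _ _ (Finset.mem_univ j₁), hj₁, ENNReal.top_rpow_of_pos (hd j₁)]
      refine ENNReal.top_mul (Finset.prod_ne_zero_iff.2 fun j _ hj => ?_)
      rcases ENNReal.rpow_eq_zero_iff.1 hj with hj | hj
      · exact h0 j hj.1
      · exact absurd hj.2 (hd j).le.not_gt
    rw [this]
    exact le_top
  obtain ⟨j₀, hj₀⟩ := h0
  -- Replace all functions by the indicators of their supports.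
  let χ : ℝ≥0 → ℝ≥0 := fun t => if t = 0 then 0 else 1
  have hχ : Measurable χ :=
    Measurable.ite (measurableSet_singleton 0) measurable_const measurable_const
  have hχ0 : ∀ {t}, χ t = 0 ↔ t = 0 := fun {t} => by simp [χ]
  have hχ1 : ∀ t, χ t ≤ 1 := fun t => by by_cases ht : t = 0 <;> simp [χ, ht]
  have key := h.prod_lintegral_le_of_ne_top hc hd (f := fun i y => χ (f i y))
    (g := fun j y => χ (g j y)) (fun i => hχ.comp (hf i)) (fun j => hχ.comp (hg j))
    (fun x => by
      by_cases hx : ∃ i, f i (u i x) = 0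
      · obtain ⟨i, hi⟩ := hx
        rw [Finset.prod_eq_zero (Finset.mem_univ i)
          (by rw [hχ0.2 hi, NNReal.zero_rpow (hc i).ne'])]
        exact zero_le
      push Not at hx
      have hpos : 0 < ∏ i, f i (u i x) ^ c i :=
        Finset.prod_pos fun i _ => NNReal.rpow_pos (pos_iff_ne_zero.2 (hx i))
      have hgx : ∀ j, g j (v j x) ≠ 0 := fun j hj => by
        refine (hpos.trans_le (hfg x)).ne' (Finset.prod_eq_zero (Finset.mem_univ j) ?_)
        rw [hj, NNReal.zero_rpow (hd j).ne']
      simp [χ, hx, hgx])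
    (fun j => ne_top_of_le_ne_top ENNReal.one_ne_top
      ((lintegral_mono fun y => ENNReal.coe_le_coe.2 (hχ1 (g j y))).trans (by simp)))
  have hz : ∫⁻ y, (χ (g j₀ y) : ℝ≥0∞) ∂(ν j₀) = 0 := by
    refine (lintegral_eq_zero_iff (hχ.comp (hg j₀)).coe_nnreal_ennreal).2 ?_
    filter_upwards [(lintegral_eq_zero_iff (hg j₀).coe_nnreal_ennreal).1 hj₀] with y hy
    simpa [hχ0] using hy
  rw [Finset.prod_eq_zero (s := Finset.univ) (f := fun j =>
    (∫⁻ y, (χ (g j y) : ℝ≥0∞) ∂(ν j)) ^ d j) (Finset.mem_univ j₀)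
    (by rw [hz, ENNReal.zero_rpow_of_pos (hd j₀)]), nonpos_iff_eq_zero,
    Finset.prod_eq_zero_iff] at key
  obtain ⟨i, -, hi⟩ := key
  have hi' : ∫⁻ y, (χ (f i y) : ℝ≥0∞) ∂(μ i) = 0 := by
    rcases ENNReal.rpow_eq_zero_iff.1 hi with hi | hi
    · exact hi.1
    · exact absurd hi.2 (hc i).le.not_gt
  have : ∫⁻ y, (f i y : ℝ≥0∞) ∂(μ i) = 0 := by
    refine (lintegral_eq_zero_iff (hf i).coe_nnreal_ennreal).2 ?_
    filter_upwards [(lintegral_eq_zero_iff (hχ.comp (hf i)).coe_nnreal_ennreal).1 hi'] with y hy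
    simpa [hχ0] using hy
  rw [Finset.prod_eq_zero (Finset.mem_univ i) (by rw [this, ENNReal.zero_rpow_of_pos (hc i)])]
  exact zero_le

end Truncation

section Gaussian

variable {k m : ℕ} {E : Fin k → Type*} {F : Fin m → Type*}
  [∀ i, NormedAddCommGroup (E i)] [∀ i, InnerProductSpace ℝ (E i)]
  [∀ i, FiniteDimensional ℝ (E i)]
  [∀ i, MeasurableSpace (E i)] [∀ i, BorelSpace (E i)]
  [∀ j, NormedAddCommGroup (F j)] [∀ j, InnerProductSpace ℝ (F j)]
  [∀ j, FiniteDimensional ℝ (F j)]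
  [∀ j, MeasurableSpace (F j)] [∀ j, BorelSpace (F j)]
  {c : Fin k → ℝ} {d : Fin m → ℝ}
  {H : Type*} [NormedAddCommGroup H] [InnerProductSpace ℝ H] [FiniteDimensional ℝ H]
  {U : ∀ i, H →ₗ[ℝ] E i} {V : ∀ j, H →ₗ[ℝ] F j}

theorem prod_lintegral_rpow_eq {n : ℕ} {G : Fin n → Type*} [∀ i, MeasurableSpace (G i)]
    (ρ : ∀ i, Measure (G i)) [∀ i, IsProbabilityMeasure (ρ i)] (p : Fin n → ℝ)
    {f : ∀ i, G i → ℝ≥0} {a b : ℝ≥0} (ha : 0 < a) (hf : ∀ i, Measurable (f i))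
    (hfab : ∀ i y, f i y ∈ Set.Icc a b) :
    ∏ i, (∫⁻ x, (f i x : ℝ≥0∞) ∂(ρ i)) ^ p i =
      ENNReal.ofReal (Real.exp (∑ i, p i * Real.log (∫ x, (f i x : ℝ) ∂(ρ i)))) := by
  have hi : ∀ i, Integrable (fun x => (f i x : ℝ)) (ρ i) := fun i =>
    Integrable.of_bound (hf i).coe_nnreal_real.aestronglyMeasurable b
      (Filter.Eventually.of_forall fun y => by simpa using (hfab i y).2)
  have hpos : ∀ i, 0 < ∫ x, (f i x : ℝ) ∂(ρ i) := fun i => by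
    have := integral_mono (integrable_const (a : ℝ)) (hi i)
      fun y => NNReal.coe_le_coe.2 (hfab i y).1
    simp only [integral_const, probReal_univ, one_smul] at this
    exact (NNReal.coe_pos.2 ha).trans_le this
  rw [← prod_rpow_eq_exp_sum_log _ _ _ fun i _ => hpos i,
    ENNReal.ofReal_prod_of_nonneg fun i _ => Real.rpow_nonneg (hpos i).le _]
  exact Finset.prod_congr rfl fun i _ => by
    rw [lintegral_coe_eq_integral _ (hi i), ENNReal.ofReal_rpow_of_pos (hpos i)]

theorem holdsForBounded_stdGaussian (hc : ∀ i, 0 < c i) (hd : ∀ j, 0 < d j)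
    (hU : ∀ i, (U i) ∘ₗ LinearMap.adjoint (U i) = LinearMap.id)
    (hV : ∀ j, (V j) ∘ₗ LinearMap.adjoint (V j) = LinearMap.id)
    (hlift : ∀ b : ∀ i, E i,
      ∃ w, (∀ i, U i w = b i) ∧ ∑ j, d j * ‖V j w‖ ^ 2 ≤ ∑ i, c i * ‖b i‖ ^ 2) :
    HoldsForBounded c d (fun i => U i) (fun j => V j) (fun i => stdGaussian (E i))
      (fun j => stdGaussian (F j)) := by
  intro f g a b ha hf hg hfab hgab hfg
  rw [prod_lintegral_rpow_eq _ c ha hf hfab, prod_lintegral_rpow_eq _ d ha hg hgab]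
  refine ENNReal.ofReal_le_ofReal (Real.exp_le_exp.2 ?_)
  refine sum_log_integral_le hc hd hU hV hlift (a := a) (b := b) (NNReal.coe_pos.2 ha)
    (fun i => (hf i).coe_nnreal_real) (fun i y => hfab i y)
    (fun j => (hg j).coe_nnreal_real) (fun j y => hgab j y) fun x => ?_
  rw [← Real.exp_le_exp,
    ← prod_rpow_eq_exp_sum_log _ _ _ fun i _ => NNReal.coe_pos.2 (ha.trans_le (hfab i _).1),
    ← prod_rpow_eq_exp_sum_log _ _ _ fun j _ => NNReal.coe_pos.2 (ha.trans_le (hgab j _).1)]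
  exact_mod_cast hfg x

end Gaussian

end FRBL

namespace FRBL

variable {k m : ℕ}
  (E : Fin k → Type*) (F : Fin m → Type*)
  [∀ i, NormedAddCommGroup (E i)] [∀ i, InnerProductSpace ℝ (E i)]
  [∀ i, FiniteDimensional ℝ (E i)]
  [∀ i, MeasurableSpace (E i)] [∀ i, BorelSpace (E i)]
  [∀ j, NormedAddCommGroup (F j)] [∀ j, InnerProductSpace ℝ (F j)]
  [∀ j, FiniteDimensional ℝ (F j)]
  [∀ j, MeasurableSpace (F j)] [∀ j, BorelSpace (F j)]

/-- **Theorem (geometric forward-reverse Brascamp-Lieb inequality with gaussian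
weights).** -/
theorem geometric_FRBL_gaussian_weights
    (c : Fin k → ℝ) (d : Fin m → ℝ)
    (hc : ∀ i, 0 < c i) (hd : ∀ j, 0 < d j)
    (H : Type*) [NormedAddCommGroup H] [InnerProductSpace ℝ H] [FiniteDimensional ℝ H]
    (Q : H →ₗ[ℝ] H) (hQ : Q.IsSymmetric)
    (U : ∀ i, H →ₗ[ℝ] E i) (V : ∀ j, H →ₗ[ℝ] F j)
    (hU : ∀ i, (U i) ∘ₗ LinearMap.adjoint (U i) = LinearMap.id)
    (hV : ∀ j, (V j) ∘ₗ LinearMap.adjoint (V j) = LinearMap.id)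
    (hsum : Q + (∑ i, c i • (LinearMap.adjoint (U i) ∘ₗ (U i))) =
      ∑ j, d j • (LinearMap.adjoint (V j) ∘ₗ (V j)))
    (hpos : PosDef (∑ j, d j • (LinearMap.adjoint (V j) ∘ₗ (V j))))
    (hdim : posIndex Q + (∑ i, Module.finrank ℝ (E i)) ≤ Module.finrank ℝ H)
    (f : ∀ i, E i → ℝ≥0) (g : ∀ j, F j → ℝ≥0)
    (hf : ∀ i, Measurable (f i)) (hg : ∀ j, Measurable (g j))
    (hyp : ∀ x : H, (∏ i, f i (U i x) ^ c i) ≤ ∏ j, g j (V j x) ^ d j) :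
    (∏ i, (∫⁻ x, (f i x : ℝ≥0∞) ∂(stdGaussian (E i))) ^ c i) ≤
      ∏ j, (∫⁻ y, (g j y : ℝ≥0∞) ∂(stdGaussian (F j))) ^ d j := by
  exact (holdsForBounded_stdGaussian hc hd hU hV
    (exists_lift hQ hsum hpos hdim)).prod_lintegral_le hc hd hf hg hyp

end FRBL
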